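/- arXiv:2002.12594 — 2 statements merged into one kernel-verified Lean document; each statement's English description precedes it below -/
import Mathlib

section
/- For every integer r ≥ 2 there exists η₀ > 0 such that for every 0 < η ≤ η₀ there exists ν₀ > 0 such that for every 0 < ν ≤ ν₀ there exists n₀ ∈ ℕ so that the following holds for all n ≥ n₀. Suppose G is a graph on n vertices with δ(G) ≥ (1 − 1/r + η)n. Then V(G) contains a set M with |M| ≤ νn such that for every W ⊆ V(G) \ M with |W| divisible by r and |W| ≤ ν³n, both G[M] and G[M ∪ W] contain perfect K_r-tilings. -/
/-- `G` restricted to the vertex set `S` has a perfect `K_r`-tiling: there is a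
collection of vertex-disjoint `r`-cliques of `G` inside `S` covering all of `S`. -/
def HasPerfectKTilingOn {V : Type*} (G : SimpleGraph V) (r : ℕ) (S : Finset V) : Prop :=
  ∃ T : Finset (Finset V),
    (∀ A ∈ T, G.IsNClique r A ∧ A ⊆ S) ∧
    (T : Set (Finset V)).Pairwise (fun A B => Disjoint A B) ∧
    (∀ v ∈ S, ∃ A ∈ T, v ∈ A)

namespace AbsorbProof

open Finset

/-- Greedy count of sequences. -/
lemma greedy_count {V : Type*} [Fintype V] [DecidableEq V] (a : ℝ) (ha : 0 ≤ a)
    (C : ∀ i : ℕ, (Fin i → V) → Finset V) (m : ℕ)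
    (hC : ∀ i < m, ∀ f, a ≤ ((C i f).card : ℝ)) :
    ∃ S : Finset (Fin m → V), a ^ m ≤ (S.card : ℝ) ∧
      ∀ f ∈ S, ∀ i : Fin m, f i ∈ C i (fun j : Fin i => f ⟨j, j.2.trans i.2⟩) := by
  induction m with
  | zero => exact ⟨univ, by simp, fun f _ i => i.elim0⟩
  | succ m ih =>
    obtain ⟨S, hS, hS'⟩ := ih (fun i hi f => hC i (by omega) f)
    refine ⟨(S.sigma (fun f => C m f)).image
      (fun p => (Fin.snoc p.1 p.2 : Fin (m+1) → V)), ?_, ?_⟩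
    · rw [card_image_of_injective, card_sigma]
      · push_cast
        calc a ^ (m+1) = a ^ m * a := pow_succ _ _
          _ ≤ S.card * a := by gcongr
          _ = ∑ f ∈ S, a := by simp
          _ ≤ _ := sum_le_sum (fun f _ => hC m (by omega) f)
      · rintro ⟨f, v⟩ ⟨g, w⟩ h
        simp only [Fin.snoc_inj] at h
        obtain ⟨rfl, rfl⟩ := h
        rfl
    · intro f hf i
      simp only [mem_image, mem_sigma] at hf
      obtain ⟨⟨g, v⟩, ⟨hg, hv⟩, rfl⟩ := hf
      simp only at hg hv
      refine Fin.lastCases ?_ (fun i => ?_) i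
      · simp only [Fin.snoc_last]
        have e : (fun j : Fin m => (Fin.snoc g v : Fin (m+1) → V) ⟨j, j.2.trans (Fin.last m).2⟩)
            = g := by
          funext j
          exact Fin.snoc_castSucc (α := fun _ => V) v g j
        exact (congrArg (fun t => v ∈ C m t) e).mpr hv
      · have := hS' g hg i
        rw [Fin.snoc_castSucc (α := fun _ => V) v g i]
        have e : (fun j : Fin i => (Fin.snoc g v : Fin (m+1) → V)
            ⟨j, j.2.trans (i.castSucc).2⟩) = fun j : Fin i => g ⟨j, j.2.trans i.2⟩ := by
          funext j
          exact Fin.snoc_castSucc (α := fun _ => V) v g ⟨j, j.2.trans i.2⟩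
        exact (congrArg (fun t => g i ∈ C i t) e).mpr this

/-- Greedy (derandomized) selection of a disjoint family. -/
lemma greedy_family {Q X V : Type*} [Fintype Q] [Fintype X] [Nonempty Q] [Nonempty X]
    [DecidableEq X] [DecidableEq V]
    (A : Q → X → Prop) (supp : X → Finset V) (m k : ℕ) (c : ℝ) (hc : 0 < c)
    (hne : ∀ q x, A q x → (supp x).Nonempty) (hcard : ∀ x, (supp x).card ≤ m)
    (h : ∀ q, ∀ U : Finset V, U.card ≤ m * k → ∃ S : Finset X,
      c * Fintype.card X ≤ (S.card : ℝ) ∧ ∀ x ∈ S, A q x ∧ Disjoint (supp x) U)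
    (j : ℕ) (hj : j ≤ k) :
    ∃ F : Finset X, F.card = j ∧ (∀ x ∈ F, ∃ q, A q x) ∧
      (F : Set X).Pairwise (fun x y => Disjoint (supp x) (supp y)) ∧
      ∃ N : Q → ℕ, (∀ q, ∃ F' ⊆ F, F'.card = N q ∧ ∀ x ∈ F', A q x) ∧
      ∑ q, (1/2 : ℝ) ^ (N q) ≤ Fintype.card Q * (1 - c/2) ^ j := by
  classical
  induction j with
  | zero =>
    refine ⟨∅, by simp, by simp, by simp, fun _ => 0, fun q => ⟨∅, by simp⟩, by simp⟩
  | succ j ih =>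
    obtain ⟨F, hF, hFA, hFd, N, hN, hpot⟩ := ih (by omega)
    set w : Q → ℝ := fun q => (1/2 : ℝ) ^ (N q) with hw
    have hwpos : ∀ q, 0 < w q := fun q => by positivity
    set U := F.biUnion supp with hU
    have hUc : U.card ≤ m * k := by
      calc U.card ≤ F.card * m := card_biUnion_le_card_mul _ _ _ (fun x _ => hcard x)
        _ ≤ m * k := by rw [hF, mul_comm]; gcongr; omega
    choose S hS hS' using fun q => h q U hUc
    have hsum : ∑ x : X, (c * ∑ q, w q) ≤ ∑ x : X, ∑ q, (if x ∈ S q then w q else 0) := by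
      rw [sum_comm]
      simp only [sum_const, card_univ, nsmul_eq_mul, sum_ite_mem, univ_inter]
      calc (Fintype.card X : ℝ) * (c * ∑ q, w q) = ∑ q, (c * Fintype.card X) * w q := by
            rw [← mul_sum]; ring
        _ ≤ _ := sum_le_sum (fun q _ => mul_le_mul_of_nonneg_right (hS q) (hwpos q).le)
    obtain ⟨x, -, hx⟩ := exists_le_of_sum_le univ_nonempty hsum
    have hpos : 0 < c * ∑ q, w q :=
      mul_pos hc (sum_pos (fun q _ => hwpos q) univ_nonempty)
    obtain ⟨q₀, hq₀⟩ : ∃ q, x ∈ S q := by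
      by_contra! hcon
      simp only [hcon, if_false, sum_const_zero] at hx
      linarith
    have hxd : Disjoint (supp x) U := (hS' q₀ x hq₀).2
    have hxA := (hS' q₀ x hq₀).1
    have hxd' : ∀ y ∈ F, Disjoint (supp x) (supp y) := fun y hy =>
      hxd.mono_right (subset_biUnion_of_mem supp hy)
    have hxF : x ∉ F := by
      intro hxF
      have := hxd' x hxF
      rw [disjoint_self] at this
      exact (hne q₀ x hxA).ne_empty this
    refine ⟨insert x F, by rw [card_insert_of_notMem hxF, hF], ?_, ?_,
      fun q => if x ∈ S q then N q + 1 else N q, ?_, ?_⟩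
    · intro y hy
      rcases mem_insert.1 hy with rfl | hy
      · exact ⟨q₀, hxA⟩
      · exact hFA y hy
    · rw [coe_insert]
      refine hFd.insert (fun y hy _ => ⟨hxd' y hy, (hxd' y hy).symm⟩)
    · intro q
      obtain ⟨F', h1, h2, h3⟩ := hN q
      by_cases hq : x ∈ S q
      · refine ⟨insert x F', insert_subset_insert _ h1, ?_, ?_⟩
        · rw [card_insert_of_notMem (fun h => hxF (h1 h)), h2]; simp [hq]
        · intro y hy
          rcases mem_insert.1 hy with rfl | hy
          · exact (hS' q _ hq).1
          · exact h3 y hy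
      · exact ⟨F', h1.trans (subset_insert _ _), by simp [hq, h2], h3⟩
    · have e : ∀ q, (1/2 : ℝ) ^ (if x ∈ S q then N q + 1 else N q)
          = w q - (1/2) * (if x ∈ S q then w q else 0) := by
        intro q
        split_ifs
        · simp only [hw]; rw [pow_succ]; ring
        · simp [hw]
      simp only [e]
      rw [sum_sub_distrib, ← mul_sum]
      have hcc : c ≤ 1 := by
        have hle : ∑ q, (if x ∈ S q then w q else 0) ≤ ∑ q, w q :=
          sum_le_sum (fun q _ => by split_ifs <;> [rfl; exact (hwpos q).le])
        have : 0 < ∑ q, w q := sum_pos (fun q _ => hwpos q) univ_nonempty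
        by_contra! hcon
        nlinarith
      calc _ ≤ (∑ q, w q) * (1 - c/2) := by linarith
        _ ≤ (Fintype.card Q * (1 - c/2) ^ j) * (1 - c/2) := by
            apply mul_le_mul_of_nonneg_right hpot; linarith
        _ = _ := by rw [pow_succ]; ring

lemma tiling_of_rows {V κ : Type*} [DecidableEq V] [Fintype κ] (G : SimpleGraph V) (r : ℕ)
    (z : κ × Fin r → V) (hz : Function.Injective z)
    (hadj : ∀ k j j', j ≠ j' → G.Adj (z (k, j)) (z (k, j'))) :
    HasPerfectKTilingOn G r (univ.image z) := by
  classical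
  refine ⟨univ.image (fun k => univ.image (fun j => z (k, j))), ?_, ?_, ?_⟩
  · intro A hA
    obtain ⟨k, -, rfl⟩ := mem_image.1 hA
    refine ⟨⟨?_, ?_⟩, ?_⟩
    · intro a ha b hb hab
      simp only [coe_image, coe_univ, Set.image_univ, Set.mem_range] at ha hb
      obtain ⟨i, rfl⟩ := ha
      obtain ⟨j, rfl⟩ := hb
      exact hadj k i j (fun h => hab (by rw [h]))
    · rw [card_image_of_injective]
      · simp
      · intro i j h
        simpa using hz h
    · intro v hv
      obtain ⟨j, -, rfl⟩ := mem_image.1 hv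
      exact mem_image_of_mem _ (mem_univ _)
  · intro A hA B hB hAB
    obtain ⟨k, -, rfl⟩ := mem_image.1 (mem_coe.1 hA)
    obtain ⟨l, -, rfl⟩ := mem_image.1 (mem_coe.1 hB)
    rw [disjoint_left]
    intro v hv hv'
    obtain ⟨j, -, rfl⟩ := mem_image.1 hv
    obtain ⟨j', -, h⟩ := mem_image.1 hv'
    have := hz h
    simp only [Prod.mk.injEq] at this
    exact hAB (by rw [this.1])
  · intro v hv
    obtain ⟨⟨k, j⟩, -, rfl⟩ := mem_image.1 hv
    exact ⟨_, mem_image_of_mem _ (mem_univ k), mem_image_of_mem _ (mem_univ j)⟩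

lemma tiling_union {V : Type*} [DecidableEq V] {G : SimpleGraph V} {r : ℕ}
    {S T : Finset V} (hd : Disjoint S T) (hS : HasPerfectKTilingOn G r S)
    (hT : HasPerfectKTilingOn G r T) : HasPerfectKTilingOn G r (S ∪ T) := by
  classical
  obtain ⟨A, a1, a2, a3⟩ := hS
  obtain ⟨B, b1, b2, b3⟩ := hT
  refine ⟨A ∪ B, ?_, ?_, ?_⟩
  · intro C hC
    rcases mem_union.1 hC with h | h
    · exact ⟨(a1 C h).1, (a1 C h).2.trans subset_union_left⟩
    · exact ⟨(b1 C h).1, (b1 C h).2.trans subset_union_right⟩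
  · intro C hC D hD hCD
    rcases mem_union.1 (mem_coe.1 hC) with h | h <;> rcases mem_union.1 (mem_coe.1 hD) with h' | h'
    · exact a2 h h' hCD
    · exact hd.mono (a1 C h).2 (b1 D h').2
    · exact (hd.mono (a1 D h').2 (b1 C h).2).symm
    · exact b2 h h' hCD
  · intro v hv
    rcases mem_union.1 hv with h | h
    · obtain ⟨C, h1, h2⟩ := a3 v h
      exact ⟨C, mem_union_left _ h1, h2⟩
    · obtain ⟨C, h1, h2⟩ := b3 v h
      exact ⟨C, mem_union_right _ h1, h2⟩

/-- Pattern of required edges among the positions of an absorber. -/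
def Pat (r a b : ℕ) : Prop := a % r = b % r ∨ (a < r ∧ b < r)

/-- `x` is an absorber for the tuple `q`. -/
def Abs {V : Type*} (G : SimpleGraph V) (r : ℕ) (hr : 0 < r) (q : Fin r → V)
    (x : Fin (r * r) → V) : Prop :=
  Function.Injective x ∧
  (∀ a b : Fin (r * r), a ≠ b → Pat r a b → G.Adj (x a) (x b)) ∧
  (∀ b : Fin (r * r), r ≤ b.1 → G.Adj (x b) (q ⟨b.1 % r, Nat.mod_lt _ hr⟩))

lemma abs_tile {V : Type*} [DecidableEq V] {G : SimpleGraph V} {r : ℕ} {hr : 0 < r}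
    {q : Fin r → V} {x : Fin (r * r) → V} (h : Abs G r hr q x) :
    HasPerfectKTilingOn G r (univ.image x) := by
  obtain ⟨h1, h2, -⟩ := h
  set y : Fin r × Fin r → V := fun p => x (finProdFinEquiv (p.2, p.1)) with hy
  have hyi : Function.Injective y := by
    intro p p' hp
    have := finProdFinEquiv.injective (h1 hp)
    simp only [Prod.mk.injEq] at this
    exact Prod.ext this.2 this.1
  have : univ.image x = univ.image y := by
    ext v
    simp only [mem_image, mem_univ, true_and]
    constructor
    · rintro ⟨a, rfl⟩
      exact ⟨((finProdFinEquiv.symm a).2, (finProdFinEquiv.symm a).1), by simp only [hy, Prod.mk.eta, Equiv.apply_symm_apply]⟩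
    · rintro ⟨p, rfl⟩
      exact ⟨_, rfl⟩
  rw [this]
  refine tiling_of_rows G r y hyi ?_
  intro k j j' hjj
  refine h2 _ _ ?_ ?_
  · intro h
    have := finProdFinEquiv.injective h
    simp only [Prod.mk.injEq] at this
    exact hjj this.1
  · left
    simp [finProdFinEquiv, Nat.add_mul_mod_self_left]

lemma abs_tile' {V : Type*} [DecidableEq V] {G : SimpleGraph V} {r : ℕ} {hr : 0 < r}
    {q : Fin r → V} {x : Fin (r * r) → V} (h : Abs G r hr q x) (hq : Function.Injective q)
    (hd : Disjoint (univ.image q) (univ.image x)) :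
    HasPerfectKTilingOn G r (univ.image x ∪ univ.image q) := by
  obtain ⟨h1, h2, h3⟩ := h
  have hd' : ∀ i a, q i ≠ x a := by
    intro i a hia
    refine disjoint_left.1 hd (mem_image_of_mem q (mem_univ i)) ?_
    rw [hia]; exact mem_image_of_mem x (mem_univ a)
  let z0 : Fin r := ⟨0, hr⟩
  let z : Option (Fin r) × Fin r → V := fun p => match p with
    | (none, i) => x (finProdFinEquiv (z0, i))
    | (some i, j) => if j = z0 then q i else x (finProdFinEquiv (j, i))
  have hxe : ∀ j i j' i', x (finProdFinEquiv (j, i)) = x (finProdFinEquiv (j', i')) →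
      j = j' ∧ i = i' := by
    intro j i j' i' hh
    have := finProdFinEquiv.injective (h1 hh)
    simpa only [Prod.mk.injEq] using this
  have hz : Function.Injective z := by
    rintro ⟨_ | i, j⟩ ⟨_ | i', j'⟩ hh <;> simp only [z] at hh
    · rw [(hxe _ _ _ _ hh).2]
    · split_ifs at hh with hc
      · exact absurd hh.symm (hd' _ _)
      · exact absurd (hxe _ _ _ _ hh).1.symm hc
    · split_ifs at hh with hc
      · exact absurd hh (hd' _ _)
      · exact absurd (hxe _ _ _ _ hh).1 hc
    · split_ifs at hh with hc hc' hc'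
      · rw [hq hh, hc, hc']
      · exact absurd hh (hd' _ _)
      · exact absurd hh.symm (hd' _ _)
      · rw [(hxe _ _ _ _ hh).1, (hxe _ _ _ _ hh).2]
  have himg : univ.image x ∪ univ.image q = univ.image z := by
    ext v
    simp only [mem_union, mem_image, mem_univ, true_and]
    constructor
    · rintro (⟨a, rfl⟩ | ⟨i, rfl⟩)
      · obtain ⟨⟨j, i⟩, rfl⟩ := finProdFinEquiv.surjective a
        by_cases hj : j = z0
        · exact ⟨(none, i), by simp only [z, hj]⟩
        · exact ⟨(some i, j), by simp only [z, hj, if_false]⟩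
      · exact ⟨(some i, z0), by simp only [z, if_true]⟩
    · rintro ⟨⟨_ | i, j⟩, rfl⟩
      · exact Or.inl ⟨_, rfl⟩
      · simp only [z]
        split_ifs
        · exact Or.inr ⟨_, rfl⟩
        · exact Or.inl ⟨_, rfl⟩
  have hneq : ∀ j i j' i', (j ≠ j' ∨ i ≠ i') →
      (finProdFinEquiv (j, i) : Fin (r * r)) ≠ finProdFinEquiv (j', i') := by
    intro j i j' i' hh he
    have := finProdFinEquiv.injective he
    simp only [Prod.mk.injEq] at this
    tauto
  have hqx : ∀ i j, j ≠ z0 → G.Adj (x (finProdFinEquiv (j, i))) (q i) := by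
    intro i j hj
    have hj0 : 1 ≤ j.1 := by
      rcases Nat.eq_zero_or_pos j.1 with h | h
      · exact absurd (Fin.ext h) hj
      · exact h
    have := h3 (finProdFinEquiv (j, i)) (by
      simp only [finProdFinEquiv_apply_val]; nlinarith)
    convert this using 2
    apply Fin.ext
    simp only [finProdFinEquiv_apply_val, Nat.add_mul_mod_self_left]
    exact (Nat.mod_eq_of_lt i.2).symm
  rw [himg]
  refine tiling_of_rows G r z hz ?_
  rintro (_ | i) j j' hjj
  · refine h2 _ _ (hneq _ _ _ _ (Or.inr hjj)) (Or.inr ?_)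
    simp [z0]
  · simp only [z]
    split_ifs with hc hc' hc'
    · exact absurd (hc.trans hc'.symm) hjj
    · exact (hqx _ _ hc').symm
    · exact hqx _ _ hc
    · refine h2 _ _ (hneq _ _ _ _ (Or.inl hjj)) (Or.inl ?_)
      simp [Nat.add_mul_mod_self_left]

lemma absorb_all {V : Type*} [DecidableEq V] {G : SimpleGraph V} {r : ℕ} (hr : 0 < r)
    (s : ℕ) : ∀ (F : Finset (Fin (r * r) → V)) (_ : ∀ x ∈ F, ∃ q, Abs G r hr q x)
      (_ : (F : Set (Fin (r * r) → V)).Pairwise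
        (fun x y => Disjoint (univ.image x) (univ.image y)))
      (_ : ∀ q, ∃ F' ⊆ F, s ≤ F'.card ∧ ∀ x ∈ F', Abs G r hr q x)
      (W : Finset V) (_ : W.card = r * s)
      (_ : Disjoint W (F.biUnion (fun x => univ.image x))),
      HasPerfectKTilingOn G r (F.biUnion (fun x => univ.image x) ∪ W) := by
  classical
  induction s with
  | zero =>
    intro F hF hFd _ W hW _
    have : W = ∅ := by simpa using hW
    subst this
    rw [union_empty]
    induction F using Finset.induction_on with
    | empty => exact ⟨∅, by simp, by simp, by simp⟩
    | insert x F hx ih =>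
      rw [biUnion_insert]
      refine tiling_union ?_ ?_ (ih ?_ ?_ ?_ ?_)
      · rw [disjoint_biUnion_right]
        intro y hy
        exact hFd (by simp) (by simp [hy]) (by rintro rfl; exact hx hy)
      · obtain ⟨q, hq⟩ := hF x (by simp)
        exact abs_tile hq
      · exact fun y hy => hF y (by simp [hy])
      · exact hFd.mono (by simp)
      · exact fun q => ⟨∅, by simp⟩
      · simp
  | succ s ih =>
    intro F hF hFd hab W hW hWd
    obtain ⟨Q, hQW, hQc⟩ : ∃ Q ⊆ W, Q.card = r :=
      exists_subset_card_eq (by rw [hW]; nlinarith)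
    let q : Fin r → V := fun i => (Q.equivFinOfCardEq hQc).symm i
    have hqi : Function.Injective q := fun i j hij =>
      (Q.equivFinOfCardEq hQc).symm.injective (Subtype.ext hij)
    have hqQ : univ.image q = Q := by
      apply eq_of_subset_of_card_le
      · intro v hv
        obtain ⟨i, -, rfl⟩ := mem_image.1 hv
        exact ((Q.equivFinOfCardEq hQc).symm i).2
      · rw [card_image_of_injective _ hqi]; simp [hQc]
    obtain ⟨F', h1, h2, h3⟩ := hab q
    obtain ⟨x, hx⟩ : F'.Nonempty := card_pos.1 (by omega)
    have hxF := h1 hx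
    have hins : F.biUnion (fun x => univ.image x) =
        univ.image x ∪ (F.erase x).biUnion (fun x => univ.image x) := by
      conv_lhs => rw [← insert_erase hxF, biUnion_insert]
    have hxW : Disjoint W (univ.image x) :=
      hWd.mono_right (subset_biUnion_of_mem (fun x => univ.image x) hxF)
    have hEW : Disjoint W ((F.erase x).biUnion (fun x => univ.image x)) :=
      hWd.mono_right (biUnion_subset_biUnion_of_subset_left _ (erase_subset _ _))
    have hxE : Disjoint (univ.image x) ((F.erase x).biUnion (fun x => univ.image x)) := by
      rw [disjoint_biUnion_right]
      intro y hy
      exact hFd hxF (mem_of_mem_erase hy) (ne_of_mem_erase hy).symm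
    have key : F.biUnion (fun x => univ.image x) ∪ W =
        (univ.image x ∪ univ.image q) ∪
          ((F.erase x).biUnion (fun x => univ.image x) ∪ (W \ Q)) := by
      rw [hins, hqQ]
      conv_lhs => rw [← union_sdiff_of_subset hQW]
      ac_rfl
    rw [key]
    refine tiling_union ?_ (abs_tile' (h3 x hx) hqi ?_) (ih _ ?_ ?_ ?_ _ ?_ ?_)
    · rw [hqQ, disjoint_union_left, disjoint_union_right, disjoint_union_right]
      exact ⟨⟨hxE, (hxW.mono_left sdiff_subset).symm⟩, hEW.mono_left hQW, disjoint_sdiff⟩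
    · rw [hqQ]; exact hxW.mono_left hQW
    · exact fun y hy => hF y (mem_of_mem_erase hy)
    · exact hFd.mono (by simp)
    · intro q'
      obtain ⟨F'', g1, g2, g3⟩ := hab q'
      refine ⟨F''.erase x, erase_subset_erase _ g1, ?_, fun y hy => g3 y (mem_of_mem_erase hy)⟩
      have := pred_card_le_card_erase (s := F'') (a := x)
      omega
    · rw [card_sdiff_of_subset hQW, hW, hQc, mul_add, mul_one, Nat.add_sub_cancel]
    · exact hEW.mono_left sdiff_subset

/-- positions preceding `b` which are required to be adjacent to position `b` -/
lemma pat_count (r : ℕ) (hr : 0 < r) (b : ℕ) (hb : b < r * r) (P : Finset (Fin b))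
    (hP : ∀ a ∈ P, Pat r a b) : P.card + (if r ≤ b then 1 else 0) ≤ r := by
  split_ifs with h
  · have : P.card ≤ (range (b / r)).card := by
      apply card_le_card_of_injOn (fun a => a.1 / r)
      · intro a ha
        rcases hP a ha with h' | h'
        · simp only [coe_range, Set.mem_Iio]
          have e1 := Nat.div_add_mod a.1 r
          have e2 := Nat.div_add_mod b r
          have := a.2
          by_contra! hc
          have := Nat.mul_le_mul_left r hc
          omega
        · omega
      · intro a ha a' ha' haa
        simp only at haa
        have h1 : a.1 % r = b % r := by rcases hP a ha with h' | h' <;> omega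
        have h2 : a'.1 % r = b % r := by rcases hP a' ha' with h' | h' <;> omega
        apply Fin.ext
        rw [← Nat.div_add_mod a.1 r, ← Nat.div_add_mod a'.1 r, haa, h1, h2]
    rw [card_range] at this
    have : b / r < r := Nat.div_lt_of_lt_mul hb
    omega
  · have := card_le_univ P
    simp at this
    omega

lemma abs_count {n r : ℕ} (hr : 2 ≤ r) (G : SimpleGraph (Fin n)) [DecidableRel G.Adj]
    (η ν : ℝ) (hη : 0 < η) (hν : ν ≤ η / 2)
    (hn : (r * r : ℝ) ≤ η / 2 * n)
    (hdeg : (G.minDegree : ℝ) ≥ (1 - 1 / r + η) * n)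
    (q : Fin r → Fin n) (U : Finset (Fin n)) (hU : (U.card : ℝ) ≤ ν * n) :
    ∃ S : Finset (Fin (r * r) → Fin n), (η * n) ^ (r * r) ≤ (S.card : ℝ) ∧
      ∀ x ∈ S, Abs G r (by omega) q x ∧ Disjoint (univ.image x) U := by
  classical
  have hr0 : 0 < r := by omega
  let C : ∀ i : ℕ, (Fin i → Fin n) → Finset (Fin n) := fun i g =>
    univ.filter (fun v => v ∉ U ∧ (∀ j, v ≠ g j) ∧ (∀ j : Fin i, Pat r j i → G.Adj v (g j)) ∧
      (r ≤ i → G.Adj v (q ⟨i % r, Nat.mod_lt _ hr0⟩)))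
  have hC : ∀ i < r * r, ∀ f, η * n ≤ ((C i f).card : ℝ) := by
    intro i hi g
    let P : Finset (Fin i) := univ.filter (fun j => Pat r j i)
    let N : Fin n → Finset (Fin n) := fun u => (G.neighborFinset u)ᶜ
    let D : Finset (Fin n) := if r ≤ i then N (q ⟨i % r, Nat.mod_lt _ hr0⟩) else ∅
    have hcov : (univ : Finset (Fin n)) ⊆
        C i g ∪ (U ∪ (univ.image g ∪ (P.biUnion (fun j => N (g j)) ∪ D))) := by
      intro v _
      by_contra hv
      simp only [mem_union, not_or] at hv
      obtain ⟨v1, v2, v3, v4, v5⟩ := hv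
      apply v1
      simp only [C, mem_filter, mem_univ, true_and]
      refine ⟨v2, ?_, ?_, ?_⟩
      · rintro j rfl
        exact v3 (mem_image_of_mem _ (mem_univ _))
      · intro j hj
        by_contra hadj
        apply v4
        rw [mem_biUnion]
        refine ⟨j, by simp [P, hj], ?_⟩
        simp only [N, mem_compl, SimpleGraph.mem_neighborFinset]
        exact fun h => hadj h.symm
      · intro hri
        by_contra hadj
        apply v5
        simp only [D, if_pos hri, N, mem_compl, SimpleGraph.mem_neighborFinset]
        exact fun h => hadj h.symm
    have hNc : ∀ u, (N u).card ≤ n - G.minDegree := by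
      intro u
      simp only [N, card_compl, Fintype.card_fin, SimpleGraph.card_neighborFinset_eq_degree]
      have := G.minDegree_le_degree u
      omega
    have c1 := card_le_card hcov
    have c2 := card_union_le (C i g) (U ∪ (univ.image g ∪ (P.biUnion (fun j => N (g j)) ∪ D)))
    have c3 := card_union_le U (univ.image g ∪ (P.biUnion (fun j => N (g j)) ∪ D))
    have c4 := card_union_le (univ.image g) (P.biUnion (fun j => N (g j)) ∪ D)
    have c5 := card_union_le (P.biUnion (fun j => N (g j))) D
    have c6 : (P.biUnion (fun j => N (g j))).card ≤ P.card * (n - G.minDegree) :=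
      card_biUnion_le_card_mul _ _ _ (fun j _ => hNc _)
    have c7 : D.card ≤ (if r ≤ i then 1 else 0) * (n - G.minDegree) := by
      simp only [D]
      split_ifs
      · simpa using hNc _
      · simp
    have c8 : (univ.image g).card ≤ r * r := by
      refine card_image_le.trans ?_
      simp; omega
    have c9 := Nat.mul_le_mul_right (n - G.minDegree)
      (pat_count r hr0 i hi P (fun a ha => (mem_filter.1 ha).2))
    rw [card_univ, Fintype.card_fin] at c1
    rw [add_mul] at c9
    have hmd : G.minDegree ≤ n := by
      by_cases hn0 : n = 0
      · subst hn0; simp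
      · have v : Fin n := ⟨0, by omega⟩
        have h1 := G.minDegree_le_degree v
        have h2 := G.degree_lt_card_verts v
        rw [Fintype.card_fin] at h2
        omega
    have main : n ≤ (C i g).card + (U.card + (r * r + r * (n - G.minDegree))) := by omega
    have main' : (n : ℝ) ≤ (C i g).card + (U.card + (r * r + r * (n - G.minDegree))) := by
      have := (Nat.cast_le (α := ℝ)).2 main
      push_cast [Nat.cast_sub hmd] at this
      exact this
    have hrR : (2 : ℝ) ≤ r := by exact_mod_cast hr
    have hrm : (r : ℝ) * (n - G.minDegree) ≤ n - r * η * n := by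
      have : (r : ℝ) * (n - G.minDegree) ≤ r * (n - (1 - 1 / r + η) * n) := by
        gcongr
      have e : (r : ℝ) * (n - (1 - 1 / r + η) * n) = n - r * η * n := by
        field_simp; ring
      linarith
    have hn0 : (0 : ℝ) ≤ n := Nat.cast_nonneg n
    have t1 : 2 * (η * n) ≤ r * (η * n) := by gcongr
    have t2 : ν * n ≤ η / 2 * n := by gcongr
    nlinarith
  obtain ⟨S, hS, hS'⟩ := greedy_count (η * n) (by positivity) C (r * r) hC
  refine ⟨S, hS, fun x hx => ?_⟩
  have hx' := hS' x hx
  simp only [C, mem_filter, mem_univ, true_and] at hx'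
  refine ⟨⟨?_, ?_, ?_⟩, ?_⟩
  · intro a b hab
    by_contra hne
    rcases lt_or_gt_of_ne hne with h | h
    · exact (hx' b).2.1 ⟨a, h⟩ hab.symm
    · exact (hx' a).2.1 ⟨b, h⟩ hab
  · intro a b hne hp
    rcases lt_or_gt_of_ne hne with h | h
    · exact ((hx' b).2.2.1 ⟨a, h⟩ hp).symm
    · refine (hx' a).2.2.1 ⟨b, h⟩ ?_
      rcases hp with hp | hp
      · exact Or.inl hp.symm
      · exact Or.inr ⟨hp.2, hp.1⟩
  · intro b hb
    exact (hx' b).2.2.2 hb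
  · rw [disjoint_left]
    intro v hv hvU
    obtain ⟨a, -, rfl⟩ := mem_image.1 hv
    exact (hx' a).1 hvU

lemma large_n (A B ε : ℝ) (hε : 0 < ε) :
    ∃ n₀ : ℕ, ∀ n : ℕ, n₀ ≤ n → A * Real.log n + B < ε * n := by
  have h1 : Filter.Tendsto (fun x : ℝ => Real.log x / x) Filter.atTop (nhds 0) :=
    Real.isLittleO_log_id_atTop.tendsto_div_nhds_zero
  have h2 : Filter.Tendsto (fun x : ℝ => A * (Real.log x / x) + B / x) Filter.atTop
      (nhds (A * 0 + 0)) :=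
    (h1.const_mul A).add (Filter.Tendsto.const_div_atTop Filter.tendsto_id B)
  simp only [mul_zero, add_zero] at h2
  have h3 := (h2.comp (tendsto_natCast_atTop_atTop (R := ℝ))).eventually (gt_mem_nhds hε)
  have h4 := h3.and (Filter.eventually_ge_atTop 1)
  obtain ⟨n₀, h⟩ := Filter.eventually_atTop.1 h4
  refine ⟨n₀, fun n hn => ?_⟩
  obtain ⟨ha, hb⟩ := h n hn
  have hn0 : (0 : ℝ) < n := by exact_mod_cast hb
  simp only [Function.comp] at ha
  have e : A * (Real.log n / n) + B / n = (A * Real.log n + B) / n := by ring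
  rw [e, div_lt_iff₀ hn0] at ha
  exact ha

end AbsorbProof

/-- The absorbing lemma: under minimum degree `(1 - 1/r + η)n` there is a small
set `M` that is `K_r`-absorbing for every small set `W` disjoint from it whose
size is divisible by `r`. -/
theorem absorbing_lemma (r : ℕ) (hr : 2 ≤ r) :
    ∃ η₀ : ℝ, 0 < η₀ ∧ ∀ η : ℝ, 0 < η → η ≤ η₀ →
      ∃ ν₀ : ℝ, 0 < ν₀ ∧ ∀ ν : ℝ, 0 < ν → ν ≤ ν₀ →
        ∃ n₀ : ℕ, ∀ n : ℕ, n₀ ≤ n →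
          ∀ (G : SimpleGraph (Fin n)) [DecidableRel G.Adj],
            (G.minDegree : ℝ) ≥ (1 - 1 / r + η) * n →
            ∃ M : Finset (Fin n), (M.card : ℝ) ≤ ν * n ∧
              ∀ W : Finset (Fin n), Disjoint W M → r ∣ W.card →
                (W.card : ℝ) ≤ ν ^ 3 * n →
                HasPerfectKTilingOn G r M ∧ HasPerfectKTilingOn G r (M ∪ W) := by
  classical
  have hr0 : 0 < r := by omega
  have hrR : (2 : ℝ) ≤ r := by exact_mod_cast hr
  refine ⟨1, one_pos, fun η hη hη1 => ?_⟩
  obtain ⟨c, hc⟩ : ∃ c : ℝ, c = η ^ (r * r) := ⟨_, rfl⟩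
  have hc0 : 0 < c := by rw [hc]; positivity
  have hc1 : c ≤ 1 := by rw [hc]; exact pow_le_one₀ hη.le hη1
  refine ⟨min (η / 2) (c / (8 * (r * r))), by positivity, fun ν hν hν0 => ?_⟩
  have hν1 : ν ≤ η / 2 := hν0.trans (min_le_left _ _)
  have hν2 : ν ≤ c / (8 * (r * r)) := hν0.trans (min_le_right _ _)
  obtain ⟨n₁, hn₁⟩ := AbsorbProof.large_n 0 (r * r : ℝ) (η / 2) (by positivity)
  obtain ⟨n₂, hn₂⟩ := AbsorbProof.large_n r 1 (3 * c * ν / (8 * (r * r))) (by positivity)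
  refine ⟨max (max n₁ n₂) 1, fun n hn G _ hdeg => ?_⟩
  have hm1 : (r * r : ℝ) ≤ η / 2 * n := by
    have := hn₁ n (by omega)
    linarith
  have hm2 := hn₂ n (by omega)
  have hnp : 0 < n := by omega
  have hnR : (0 : ℝ) < n := by exact_mod_cast hnp
  haveI : Nonempty (Fin n) := ⟨⟨0, hnp⟩⟩
  obtain ⟨k, hk⟩ : ∃ k : ℕ, k = ⌊ν * n / (r * r)⌋₊ := ⟨_, rfl⟩
  have hk1 : (k : ℝ) ≤ ν * n / (r * r) := by rw [hk]; exact Nat.floor_le (by positivity)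
  have hk2 : ν * n / (r * r) < k + 1 := by rw [hk]; exact Nat.lt_floor_add_one _
  have hk3 : ((r * r : ℕ) : ℝ) * k ≤ ν * n := by
    rw [le_div_iff₀ (by positivity)] at hk1
    push_cast; linarith
  obtain ⟨F, hFk, hFA, hFd, N, hN, hpot⟩ :=
    AbsorbProof.greedy_family (Q := Fin r → Fin n) (X := Fin (r * r) → Fin n)
      (AbsorbProof.Abs G r hr0) (fun x => Finset.univ.image x) (r * r) k c hc0
      (fun q x _ => by
        haveI : Nonempty (Fin (r * r)) := ⟨⟨0, by positivity⟩⟩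
        exact Finset.univ_nonempty.image _)
      (fun x => Finset.card_image_le.trans (by simp))
      (fun q U hU => by
        obtain ⟨S, h1, h2⟩ := AbsorbProof.abs_count hr G η ν hη hν1 hm1 hdeg q U
          (le_trans (by exact_mod_cast hU) hk3)
        refine ⟨S, le_trans (le_of_eq ?_) h1, h2⟩
        rw [hc, mul_pow]
        simp) k le_rfl
  have hMc : ((F.biUnion (fun x => Finset.univ.image x)).card : ℝ) ≤ ν * n := by
    refine le_trans ?_ hk3
    have : (F.biUnion (fun x => Finset.univ.image x)).card ≤ F.card * (r * r) :=
      Finset.card_biUnion_le_card_mul _ _ _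
        (fun x _ => Finset.card_image_le.trans (by simp))
    rw [hFk] at this
    have h2 := (Nat.cast_le (α := ℝ)).2 this
    push_cast at h2 ⊢
    linarith
  have habs : ∀ (s : ℕ), (s : ℝ) ≤ ν ^ 3 * n → ∀ q, s ≤ N q := by
    intro s hs q
    by_contra! hlt
    have hlt' : (N q : ℝ) ≤ ν ^ 3 * n := le_trans (by exact_mod_cast hlt.le) hs
    have h1 : (1 / 2 : ℝ) ^ (N q) ≤ (n : ℝ) ^ r * (1 - c / 2) ^ k := by
      refine le_trans (Finset.single_le_sum (f := fun q => (1 / 2 : ℝ) ^ (N q))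
        (fun _ _ => by positivity) (Finset.mem_univ q)) (hpot.trans (le_of_eq ?_))
      simp
    have h2 : Real.exp (-(N q : ℝ)) ≤ (1 / 2 : ℝ) ^ (N q) := by
      have : Real.exp (-(N q : ℝ)) = (Real.exp (-1)) ^ (N q) := by
        rw [← Real.exp_nat_mul]; ring_nf
      rw [this]
      gcongr
      rw [Real.exp_neg, one_div]
      gcongr
      have := Real.add_one_le_exp (1 : ℝ)
      linarith
    have h3 : (1 - c / 2) ^ k ≤ Real.exp (-(c / 2) * k) := by
      have : Real.exp (-(c / 2) * k) = (Real.exp (-(c / 2))) ^ k := by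
        rw [← Real.exp_nat_mul]; ring_nf
      rw [this]
      have := Real.add_one_le_exp (-(c / 2))
      exact pow_le_pow_left₀ (by linarith) (by linarith) k
    have h4 : (n : ℝ) ^ r = Real.exp (r * Real.log n) := by
      rw [Real.exp_nat_mul, Real.exp_log hnR]
    have h5 : Real.exp (-(N q : ℝ)) ≤ Real.exp (r * Real.log n + -(c / 2) * k) := by
      rw [Real.exp_add, ← h4]
      refine h2.trans (h1.trans ?_)
      gcongr
    rw [Real.exp_le_exp] at h5
    have hν3 : ν ^ 3 * n ≤ c * ν / (8 * (r * r)) * n := by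
      have h6 : ν ^ 2 ≤ ν := by nlinarith
      have h7 : ν ^ 3 ≤ c / (8 * (r * r)) * ν := by
        calc ν ^ 3 = ν ^ 2 * ν := by ring
          _ ≤ c / (8 * (r * r)) * ν := by gcongr; linarith
      calc ν ^ 3 * n ≤ c / (8 * (r * r)) * ν * n := by gcongr
        _ = _ := by ring
    have h8 : c / 2 * (ν * n / (r * r)) ≤ c / 2 * (k + 1) := by gcongr
    have h9 : c / 2 * (ν * n / (r * r)) =
        3 * c * ν / (8 * (r * r)) * n + c * ν / (8 * (r * r)) * n := by
      field_simp; ring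
    nlinarith
  refine ⟨F.biUnion (fun x => Finset.univ.image x), hMc, fun W hW hrW hWc => ?_⟩
  constructor
  · have := AbsorbProof.absorb_all hr0 0 F hFA hFd (fun q => ⟨∅, by simp⟩) ∅ (by simp) (by simp)
    simpa using this
  · obtain ⟨s, hs⟩ := hrW
    refine AbsorbProof.absorb_all hr0 s F hFA hFd (fun q => ?_) W hs hW
    obtain ⟨F', g1, g2, g3⟩ := hN q
    refine ⟨F', g1, ?_, g3⟩
    rw [g2]
    refine habs s (le_trans ?_ hWc) q
    rw [hs]
    exact_mod_cast Nat.le_mul_of_pos_left s hr0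
end

section
/- Given a graph F on vertex set {1, …, f} and d, Δ > 0, there exists ε₀ = ε₀(d, Δ, f) > 0 such that the following holds. Given L₁, …, L_f ∈ ℕ and ε ≤ ε₀, let F* be the graph obtained from F by replacing each vertex i of F with a set V_i of L_i new vertices and joining all vertices in V_i to all vertices in V_j whenever ij is an edge of F. Let G be a spanning subgraph of F* such that for every edge ij ∈ E(F) the bipartite pair (V_i, V_j) in G is (ε, d)-superregular. Then G contains a copy of every subgraph H of F* with Δ(H) ≤ Δ. -/
/-- The density `d(A,B)` of the pair `(A,B)` in the graph `H`. -/
noncomputable def dens {V : Type*} (H : SimpleGraph V) (A B : Finset V) : ℝ := by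
  classical exact ((A ×ˢ B).filter fun p => H.Adj p.1 p.2).card / (A.card * B.card)

/-- The number of neighbours of `a` in `B`, in the graph `H`. -/
noncomputable def degIn {V : Type*} (H : SimpleGraph V) (a : V) (B : Finset V) : ℕ := by
  classical exact (B.filter fun b => H.Adj a b).card

/-- The pair `(A,B)` is `(ε,d)`-superregular in `H`: all pairs of subsets of
proportion at least `ε` have density greater than `d`, and every vertex of `A` has
more than `d|B|` neighbours in `B` and vice versa. -/
def IsSuperregularPair {V : Type*} (ε d : ℝ) (H : SimpleGraph V) (A B : Finset V) : Prop :=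
  (∀ X ⊆ A, ∀ Y ⊆ B, ε * A.card ≤ X.card → ε * B.card ≤ Y.card → d < dens H X Y) ∧
  (∀ a ∈ A, d * B.card < (degIn H a B : ℝ)) ∧
  (∀ b ∈ B, d * A.card < (degIn H b A : ℝ))

/-- The degree of `x` in `H`. -/
noncomputable def deg {V : Type*} [Fintype V] (H : SimpleGraph V) (x : V) : ℕ := by
  classical exact (Finset.univ.filter fun y => H.Adj x y).card

set_option linter.unusedSectionVars false
namespace BlowUp
open Finset

section
open scoped Classical

variable {V ι : Type*} [Fintype V]

/-- neighbourhood as a finset -/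
noncomputable def nbr (G : SimpleGraph V) (u : V) : Finset V := univ.filter (fun v => G.Adj u v)

/-- a class of the partition -/
noncomputable def cl (c : V → ι) (i : ι) : Finset V := univ.filter (fun v => c v = i)

/-- candidate set of `z` -/
noncomputable def Cand (c : V → ι) (G H : SimpleGraph V) (E : Finset V) (φ : V → V) (z : V) :
    Finset V := (cl c (c z)).filter (fun v => ∀ y ∈ E, H.Adj y z → G.Adj (φ y) v)

/-- available candidate set of `z` -/
noncomputable def Av (c : V → ι) (G H : SimpleGraph V) (E : Finset V) (φ : V → V) (z : V) :
    Finset V := Cand c G H E φ z \ E.image φ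

/-- number of embedded neighbours -/
noncomputable def kk (H : SimpleGraph V) (E : Finset V) (z : V) : ℕ :=
  (E.filter (fun y => H.Adj y z)).card

/-- valid partial embedding -/
structure Valid (c : V → ι) (G H : SimpleGraph V) (E : Finset V) (φ : V → V) : Prop where
  cls : ∀ x ∈ E, c (φ x) = c x
  inj : Set.InjOn φ E
  adj : ∀ x ∈ E, ∀ y ∈ E, H.Adj x y → G.Adj (φ x) (φ y)

/-- standing hypotheses -/
structure Setup (c : V → ι) (G H : SimpleGraph V) (D : ℕ) (d ε : ℝ) : Prop where
  hd : 0 < d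
  hd2 : d ≤ 1 / 2
  hε : 0 < ε
  deg : ∀ x, (nbr H x).card ≤ D
  cls : ∀ x y, H.Adj x y → c x ≠ c y
  reg : ∀ x y, H.Adj x y → ∀ Y ⊆ cl c (c y), ε * (cl c (c y)).card ≤ Y.card →
    (((cl c (c x)).filter
      (fun u => ((nbr G u ∩ Y).card : ℝ) ≤ d * Y.card)).card : ℝ) < ε * (cl c (c x)).card
  mindeg : ∀ x y, H.Adj x y → ∀ u ∈ cl c (c x),
    d * (cl c (c y)).card < ((nbr G u ∩ cl c (c y)).card : ℝ)

variable {c : V → ι} {G H : SimpleGraph V} {D : ℕ} {d ε : ℝ}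

@[simp] lemma mem_nbr {u v : V} : v ∈ nbr G u ↔ G.Adj u v := by simp [nbr]
@[simp] lemma mem_cl {v : V} {i : ι} : v ∈ cl c i ↔ c v = i := by simp [cl]

lemma mem_Cand {E : Finset V} {φ : V → V} {z v : V} :
    v ∈ Cand c G H E φ z ↔ c v = c z ∧ ∀ y ∈ E, H.Adj y z → G.Adj (φ y) v := by
  simp [Cand]

lemma mem_Av {E : Finset V} {φ : V → V} {z v : V} :
    v ∈ Av c G H E φ z ↔ v ∈ Cand c G H E φ z ∧ v ∉ E.image φ := by
  simp [Av]

lemma Cand_subset {E : Finset V} {φ : V → V} {z : V} : Cand c G H E φ z ⊆ cl c (c z) :=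
  filter_subset _ _

lemma Av_subset {E : Finset V} {φ : V → V} {z : V} : Av c G H E φ z ⊆ cl c (c z) :=
  sdiff_subset.trans Cand_subset

lemma Cand_step_adj {E : Finset V} {φ : V → V} {y u z : V} (hy : y ∉ E) (h : H.Adj y z) :
    Cand c G H (insert y E) (Function.update φ y u) z = nbr G u ∩ Cand c G H E φ z := by
  ext v
  simp only [mem_Cand, mem_inter, mem_nbr, mem_insert, forall_eq_or_imp, Function.update_self]
  have : (∀ a ∈ E, H.Adj a z → G.Adj (Function.update φ y u a) v) ↔
      ∀ a ∈ E, H.Adj a z → G.Adj (φ a) v := by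
    refine forall₂_congr fun a ha => ?_
    rw [Function.update_of_ne (by rintro rfl; exact hy ha)]
  rw [this]; tauto

lemma Cand_step_nadj {E : Finset V} {φ : V → V} {y u z : V} (hy : y ∉ E) (h : ¬ H.Adj y z) :
    Cand c G H (insert y E) (Function.update φ y u) z = Cand c G H E φ z := by
  ext v
  simp only [mem_Cand, mem_insert, forall_eq_or_imp, Function.update_self]
  have : (∀ a ∈ E, H.Adj a z → G.Adj (Function.update φ y u a) v) ↔
      ∀ a ∈ E, H.Adj a z → G.Adj (φ a) v := by
    refine forall₂_congr fun a ha => ?_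
    rw [Function.update_of_ne (by rintro rfl; exact hy ha)]
  rw [this]; tauto

lemma kk_step_adj {E : Finset V} {y z : V} (hy : y ∉ E) (h : H.Adj y z) :
    kk H (insert y E) z = kk H E z + 1 := by
  unfold kk
  rw [filter_insert, if_pos h, card_insert_of_notMem (by simp [hy])]

lemma kk_step_nadj {E : Finset V} {y z : V} (h : ¬ H.Adj y z) :
    kk H (insert y E) z = kk H E z := by
  unfold kk
  rw [filter_insert, if_neg h]

lemma image_step {E : Finset V} {φ : V → V} {y u : V} (hy : y ∉ E) :
    (insert y E).image (Function.update φ y u) = insert u (E.image φ) := by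
  rw [image_insert, Function.update_self]
  congr 1
  refine image_congr fun a ha => ?_
  rw [Function.update_of_ne (by rintro rfl; exact hy ha)]

lemma kk_le (hS : Setup c G H D d ε) (E : Finset V) (z : V) : kk H E z ≤ D := by
  refine le_trans (card_le_card ?_) (hS.deg z)
  intro y hy
  simp only [mem_filter] at hy
  simpa using hy.2.symm

lemma Valid.step {E : Finset V} {φ : V → V} {y u : V} (hV : Valid c G H E φ) (hy : y ∉ E)
    (hu : u ∈ Av c G H E φ y) : Valid c G H (insert y E) (Function.update φ y u) := by
  rw [mem_Av, mem_Cand] at hu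
  obtain ⟨⟨h1, h2⟩, h3⟩ := hu
  have hne : ∀ a ∈ E, Function.update φ y u a = φ a := fun a ha =>
    Function.update_of_ne (by rintro rfl; exact hy ha) _ _
  refine ⟨?_, ?_, ?_⟩
  · intro x hx
    rcases mem_insert.1 hx with rfl | hx
    · simpa using h1
    · rw [hne x hx]; exact hV.cls x hx
  · rw [coe_insert, Set.injOn_insert (by simpa using hy)]
    refine ⟨fun a ha b hb hab => ?_, ?_⟩
    · rw [hne a ha, hne b hb] at hab; exact hV.inj ha hb hab
    · rintro ⟨a, ha, hab⟩
      rw [hne a ha, Function.update_self] at hab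
      exact h3 (mem_image.2 ⟨a, ha, hab⟩)
  · intro x hx z hz hxz
    rcases mem_insert.1 hx with hx' | hx' <;> rcases mem_insert.1 hz with hz' | hz'
    · subst hx' hz'; exact absurd hxz (H.loopless.irrefl _)
    · subst hx'
      rw [hne z hz', Function.update_self]; exact (h2 z hz' hxz.symm).symm
    · subst hz'
      rw [hne x hx', Function.update_self]; exact h2 x hx' hxz
    · rw [hne x hx', hne z hz']; exact hV.adj x hx' z hz' hxz

/-- `z` is good with respect to `W` -/
def Good (c : V → ι) (G H : SimpleGraph V) (d : ℝ) (E : Finset V) (φ : V → V) (z : V)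
    (W : Finset V) : Prop :=
  d ^ kk H E z * W.card ≤ ((Cand c G H E φ z ∩ W).card : ℝ)

/-- number of tracked bad vertices -/
noncomputable def bad (c : V → ι) (G H : SimpleGraph V) (d : ℝ) (T : Finset V)
    (E : Finset V) (φ : V → V) (i : ι) (W : Finset V) : ℕ :=
  ((T ∩ cl c i).filter (fun z => ¬ Good c G H d E φ z W)).card

/-- number of tracked embedded edges into the class `i` -/
noncomputable def ss (c : V → ι) (H : SimpleGraph V) (T : Finset V) (E : Finset V) (i : ι) : ℕ :=
  ∑ z ∈ T ∩ cl c i, kk H E z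

lemma ss_step {T E : Finset V} {y : V} (hy : y ∉ E) (i : ι) :
    ss c H T (insert y E) i = ss c H T E i + (nbr H y ∩ (T ∩ cl c i)).card := by
  unfold ss
  have : ∀ z ∈ T ∩ cl c i, kk H (insert y E) z = kk H E z + if H.Adj y z then 1 else 0 := by
    intro z _
    split_ifs with h
    · exact kk_step_adj hy h
    · exact kk_step_nadj h
  rw [sum_congr rfl this, sum_add_distrib, ← card_filter]
  congr 2
  ext z; simp; tauto

/-- exceptional vertices for `Y` -/
noncomputable def Exc (c : V → ι) (G : SimpleGraph V) (d : ℝ) (i : ι) (Y : Finset V) : Finset V :=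
  (cl c i).filter (fun u => ((nbr G u ∩ Y).card : ℝ) ≤ d * Y.card)

/-- one term of the potential, summed over choices -/
lemma term_step (hS : Setup c G H D d ε) {T E : Finset V} {φ : V → V} {y : V} (hy : y ∉ E)
    {i : ι} {W : Finset V} {η τ : ℝ} {m : ℕ}
    (hWc : η * (cl c i).card ≤ W.card)
    (hη : ε ≤ d ^ D * η) (Q : Finset V) (hQ : Q ⊆ cl c (c y))
    (hQc : τ * (cl c (c y)).card ≤ Q.card)
    (hM : ((2 : ℝ) ^ m) ^ D * D * ε ≤ τ) :
    ∑ u ∈ Q, ((2 : ℝ) ^ m) ^ bad c G H d T (insert y E) (Function.update φ y u) i W *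
        ((1 / 2 : ℝ) ^ ss c H T (insert y E) i) ≤
      Q.card * (((2 : ℝ) ^ m) ^ bad c G H d T E φ i W * (1 / 2 : ℝ) ^ ss c H T E i) := by
  set M : ℝ := (2 : ℝ) ^ m with hMdef
  have hM1 : 1 ≤ M := one_le_pow₀ (by norm_num)
  set Z := nbr H y ∩ (T ∩ cl c i) with hZ
  have hZD : Z.card ≤ D := (card_le_card inter_subset_left).trans (hS.deg y)
  set X := (Z.filter (fun z => Good c G H d E φ z W)).biUnion
    (fun z => Exc c G d (c y) (Cand c G H E φ z ∩ W)) with hX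
  have hXc : (X.card : ℝ) ≤ Z.card * (ε * (cl c (c y)).card) := by
    have h1 : (X.card : ℝ) ≤ ∑ z ∈ Z.filter (fun z => Good c G H d E φ z W),
        ((Exc c G d (c y) (Cand c G H E φ z ∩ W)).card : ℝ) := by
      exact_mod_cast card_biUnion_le
    refine h1.trans ?_
    have h2 : ∀ z ∈ Z.filter (fun z => Good c G H d E φ z W),
        ((Exc c G d (c y) (Cand c G H E φ z ∩ W)).card : ℝ) ≤ ε * (cl c (c y)).card := by
      intro z hz
      simp only [mem_filter, hZ, mem_inter, mem_nbr, mem_cl] at hz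
      obtain ⟨⟨hyz, hzT, hzi⟩, hg⟩ := hz
      refine (hS.reg y z hyz _ (inter_subset_left.trans Cand_subset) ?_).le
      refine le_trans ?_ hg
      have : d ^ D ≤ d ^ kk H E z :=
        pow_le_pow_of_le_one hS.hd.le (by linarith [hS.hd2]) (kk_le hS E z)
      rw [hzi]
      calc ε * ((cl c i).card : ℝ) ≤ d ^ D * η * (cl c i).card := by gcongr
        _ = d ^ D * (η * (cl c i).card) := by ring
        _ ≤ d ^ D * W.card := by
          have := hS.hd
          gcongr
        _ ≤ _ := by gcongr
    refine (sum_le_sum h2).trans ?_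
    rw [sum_const, nsmul_eq_mul]
    have : (0 : ℝ) ≤ ε * (cl c (c y)).card := mul_nonneg hS.hε.le (by positivity)
    gcongr
    exact filter_subset _ _
  have hbad : ∀ u ∈ Q, M ^ bad c G H d T (insert y E) (Function.update φ y u) i W ≤
      M ^ bad c G H d T E φ i W * (1 + if u ∈ X then M ^ D else 0) := by
    intro u hu
    have key : bad c G H d T (insert y E) (Function.update φ y u) i W ≤
        bad c G H d T E φ i W + if u ∈ X then D else 0 := by
      have hsub : ((T ∩ cl c i).filter
          (fun z => ¬ Good c G H d (insert y E) (Function.update φ y u) z W)) ⊆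
          ((T ∩ cl c i).filter (fun z => ¬ Good c G H d E φ z W)) ∪
            (if u ∈ X then Z else ∅) := by
        intro z hz
        rw [mem_filter] at hz
        obtain ⟨hzT, hzb⟩ := hz
        by_cases hg : Good c G H d E φ z W
        · refine mem_union_right _ ?_
          have hyz : H.Adj y z := by
            by_contra hyz
            apply hzb
            unfold Good at hg ⊢
            rwa [Cand_step_nadj hy hyz, kk_step_nadj hyz]
          have hzZ : z ∈ Z := by rw [hZ]; simp only [mem_inter, mem_nbr]; exact ⟨hyz, mem_inter.1 hzT⟩
          have huX : u ∈ X := by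
            rw [hX, mem_biUnion]
            refine ⟨z, mem_filter.2 ⟨hzZ, hg⟩, ?_⟩
            by_contra hue
            apply hzb
            unfold Exc at hue
            rw [mem_filter, not_and] at hue
            have h3 := hue (hQ hu)
            unfold Good at hg ⊢
            rw [Cand_step_adj hy hyz, kk_step_adj hy hyz, inter_assoc, pow_succ]
            push Not at h3
            refine le_trans ?_ h3.le
            have := hS.hd
            nlinarith [mul_le_mul_of_nonneg_left hg this.le]
          rw [if_pos huX]; exact hzZ
        · exact mem_union_left _ (mem_filter.2 ⟨hzT, hg⟩)
      refine (card_le_card hsub).trans ((card_union_le _ _).trans ?_)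
      unfold bad
      gcongr
      split_ifs
      · exact hZD
      · simp
    split_ifs at key ⊢ with h
    · calc M ^ bad c G H d T (insert y E) (Function.update φ y u) i W
          ≤ M ^ (bad c G H d T E φ i W + D) := pow_le_pow_right₀ hM1 key
        _ = M ^ bad c G H d T E φ i W * M ^ D := pow_add _ _ _
        _ ≤ _ := by gcongr; linarith
    · simpa using pow_le_pow_right₀ hM1 key
  have hsum : ∑ u ∈ Q, M ^ bad c G H d T (insert y E) (Function.update φ y u) i W ≤
      M ^ bad c G H d T E φ i W * (Q.card * 2 ^ Z.card) := by
    refine (sum_le_sum hbad).trans ?_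
    rw [← mul_sum]
    gcongr
    rw [sum_add_distrib, sum_ite_mem]
    simp only [sum_const, nsmul_eq_mul, mul_one]
    have h1 : (((Q ∩ X).card : ℕ) : ℝ) ≤ X.card := by
      exact_mod_cast card_le_card inter_subset_right
    rcases Nat.eq_zero_or_pos Z.card with h0 | h0
    · have : X.card = 0 := by
        have : (X.card : ℝ) ≤ 0 := by simpa [h0] using hXc
        exact_mod_cast le_antisymm this (by positivity)
      have h2 : (((Q ∩ X).card : ℕ) : ℝ) = 0 := by
        rw [this] at h1; push_cast at h1; exact le_antisymm h1 (by positivity)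
      rw [h2, h0]; simp
    · have h2 : (2 : ℝ) ≤ 2 ^ Z.card := by
        calc (2 : ℝ) = 2 ^ 1 := by norm_num
          _ ≤ 2 ^ Z.card := pow_le_pow_right₀ (by norm_num) h0
      have h3 : (((Q ∩ X).card : ℕ) : ℝ) * M ^ D ≤ Q.card := by
        calc (((Q ∩ X).card : ℕ) : ℝ) * M ^ D ≤ (Z.card * (ε * (cl c (c y)).card)) * M ^ D := by
              gcongr; exact h1.trans hXc
          _ ≤ (D * (ε * (cl c (c y)).card)) * M ^ D := by
              have := hS.hε
              gcongr
          _ = (M ^ D * D * ε) * (cl c (c y)).card := by ring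
          _ ≤ τ * (cl c (c y)).card := by gcongr
          _ ≤ _ := hQc
      nlinarith [(Nat.cast_nonneg Q.card : (0 : ℝ) ≤ Q.card)]
  rw [← sum_mul, ss_step hy, pow_add]
  calc _ ≤ M ^ bad c G H d T E φ i W * (Q.card * 2 ^ Z.card) *
        ((1 / 2) ^ ss c H T E i * (1 / 2) ^ Z.card) := by gcongr
    _ = Q.card * (M ^ bad c G H d T E φ i W * (1 / 2) ^ ss c H T E i) *
        (2 ^ Z.card * (1 / 2) ^ Z.card) := by ring
    _ = _ := by rw [← mul_pow]; norm_num

end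
end BlowUp


namespace BlowUp
open Finset
section
open scoped Classical
variable {V ι : Type*} [Fintype V]
variable {c : V → ι} {G H : SimpleGraph V} {D : ℕ} {d ε : ℝ}

/-- the potential -/
noncomputable def Pot (c : V → ι) (G H : SimpleGraph V) (d η : ℝ) (m : ℕ) (T : Finset V)
    (I : Finset ι) (E : Finset V) (φ : V → V) : ℝ :=
  ∑ i ∈ I, ∑ W ∈ (cl c i).powerset.filter (fun W => η * (cl c i).card ≤ W.card),
    (1 / 2 : ℝ) ^ (cl c i).card *
      (((2 : ℝ) ^ m) ^ bad c G H d T E φ i W * (1 / 2 : ℝ) ^ ss c H T E i)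

lemma step (hS : Setup c G H D d ε) {T E : Finset V} {φ : V → V} {y : V} (hy : y ∉ E)
    {η τ : ℝ} {m : ℕ} (I : Finset ι) (hη : ε ≤ d ^ D * η) (hτ : 0 < τ)
    (hM : ((2 : ℝ) ^ m) ^ D * D * ε ≤ τ)
    (hA : 2 * τ * (cl c (c y)).card ≤ (Av c G H E φ y).card)
    (Y : V → Finset V)
    (hY : ∀ z, z ∉ E → H.Adj y z → Y z ⊆ cl c (c z) ∧ ε * (cl c (c z)).card ≤ (Y z).card) :
    ∃ u ∈ Av c G H E φ y,
      (∀ z, z ∉ E → H.Adj y z → d * (Y z).card < ((nbr G u ∩ Y z).card : ℝ)) ∧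
      Pot c G H d η m T I (insert y E) (Function.update φ y u) ≤ Pot c G H d η m T I E φ := by
  set X := ((nbr H y).filter (fun z => z ∉ E)).biUnion (fun z => Exc c G d (c y) (Y z)) with hX
  set Q := Av c G H E φ y \ X with hQ
  have hn : (0 : ℝ) < (cl c (c y)).card := by
    exact_mod_cast card_pos.2 ⟨y, by simp⟩
  have hXc : (X.card : ℝ) ≤ D * (ε * (cl c (c y)).card) := by
    have h1 : (X.card : ℝ) ≤ ∑ z ∈ (nbr H y).filter (fun z => z ∉ E),
        ((Exc c G d (c y) (Y z)).card : ℝ) := by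
      exact_mod_cast card_biUnion_le
    refine h1.trans ?_
    have h2 : ∀ z ∈ (nbr H y).filter (fun z => z ∉ E),
        ((Exc c G d (c y) (Y z)).card : ℝ) ≤ ε * (cl c (c y)).card := by
      intro z hz
      simp only [mem_filter, mem_nbr] at hz
      obtain ⟨h3, h4⟩ := hY z hz.2 hz.1
      exact (hS.reg y z hz.1 _ h3 h4).le
    refine (sum_le_sum h2).trans ?_
    rw [sum_const, nsmul_eq_mul]
    have : (0 : ℝ) ≤ ε * (cl c (c y)).card := mul_nonneg hS.hε.le (by positivity)
    have h5 : ((nbr H y).filter (fun z => z ∉ E)).card ≤ D :=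
      (card_le_card (filter_subset _ _)).trans (hS.deg y)
    gcongr
  have hDε : D * ε ≤ τ := by
    refine le_trans ?_ hM
    have : (1 : ℝ) ≤ ((2 : ℝ) ^ m) ^ D := one_le_pow₀ (one_le_pow₀ (by norm_num))
    have h0 : (0 : ℝ) ≤ D * ε := mul_nonneg (by positivity) hS.hε.le
    nlinarith
  have hQc : τ * (cl c (c y)).card ≤ Q.card := by
    have h1 : (Av c G H E φ y).card ≤ Q.card + X.card := by
      rw [hQ]
      calc _ ≤ ((Av c G H E φ y \ X) ∪ X).card := card_le_card (by simp)
        _ ≤ _ := card_union_le _ _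
    have h2 : ((Av c G H E φ y).card : ℝ) ≤ Q.card + X.card := by exact_mod_cast h1
    nlinarith
  have hQpos : 0 < Q.card := by
    have : (0 : ℝ) < Q.card := lt_of_lt_of_le (by positivity) hQc
    exact_mod_cast this
  have hQs : Q ⊆ cl c (c y) := sdiff_subset.trans Av_subset
  have hsum : ∑ u ∈ Q, Pot c G H d η m T I (insert y E) (Function.update φ y u) ≤
      ∑ u ∈ Q, Pot c G H d η m T I E φ := by
    unfold Pot
    rw [sum_comm, sum_comm (s := Q)]
    refine sum_le_sum fun i _ => ?_
    rw [sum_comm, sum_comm (s := Q)]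
    refine sum_le_sum fun W hW => ?_
    rw [← mul_sum, ← mul_sum, sum_const, nsmul_eq_mul]
    gcongr
    exact term_step hS hy (mem_filter.1 hW).2 hη Q hQs hQc hM
  obtain ⟨u, huQ, hu⟩ := exists_le_of_sum_le (card_pos.1 hQpos) hsum
  rw [hQ, mem_sdiff] at huQ
  refine ⟨u, huQ.1, ?_, hu⟩
  intro z hzE hz
  by_contra hcon
  push Not at hcon
  apply huQ.2
  rw [hX, mem_biUnion]
  exact ⟨z, by simp [hz, hzE], mem_filter.2 ⟨Av_subset huQ.1, hcon⟩⟩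

lemma bad_bound (hS : Setup c G H D d ε) {T E : Finset V} {φ : V → V}
    {η : ℝ} {m : ℕ} {I : Finset ι} {f : ℕ} (hP : Pot c G H d η m T I E φ ≤ f)
    {i : ι} (hi : i ∈ I) {W : Finset V} (hW : W ⊆ cl c i) (hWc : η * (cl c i).card ≤ W.card) :
    m * bad c G H d T E φ i W ≤ f + (cl c i).card + D * (cl c i).card := by
  have hss : ss c H T E i ≤ D * (cl c i).card := by
    unfold ss
    calc _ ≤ ∑ z ∈ T ∩ cl c i, D := sum_le_sum fun z _ => kk_le hS E z
      _ = D * (T ∩ cl c i).card := by rw [sum_const, smul_eq_mul, mul_comm]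
      _ ≤ _ := by gcongr; exact inter_subset_right
  have hterm : (1 / 2 : ℝ) ^ (cl c i).card *
      (((2 : ℝ) ^ m) ^ bad c G H d T E φ i W * (1 / 2 : ℝ) ^ ss c H T E i) ≤ f := by
    refine le_trans ?_ hP
    unfold Pot
    refine le_trans ?_ (single_le_sum (f := fun i => ∑ W ∈ (cl c i).powerset.filter
      (fun W => η * (cl c i).card ≤ W.card), (1 / 2 : ℝ) ^ (cl c i).card *
      (((2 : ℝ) ^ m) ^ bad c G H d T E φ i W * (1 / 2 : ℝ) ^ ss c H T E i))
      (fun j _ => sum_nonneg fun W _ => by positivity) hi)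
    exact single_le_sum (f := fun W => (1 / 2 : ℝ) ^ (cl c i).card *
      (((2 : ℝ) ^ m) ^ bad c G H d T E φ i W * (1 / 2 : ℝ) ^ ss c H T E i))
      (fun W _ => by positivity) (mem_filter.2 ⟨mem_powerset.2 hW, hWc⟩)
  have hf : (f : ℝ) ≤ 2 ^ f := by exact_mod_cast (Nat.lt_two_pow_self).le
  have h2 : (2 : ℝ) ^ (m * bad c G H d T E φ i W) ≤
      2 ^ (f + (cl c i).card + ss c H T E i) := by
    have h3 := hterm.trans hf
    rw [← pow_mul] at h3
    calc (2 : ℝ) ^ (m * bad c G H d T E φ i W)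
        = ((1 / 2 : ℝ) ^ (cl c i).card * ((2 : ℝ) ^ (m * bad c G H d T E φ i W) *
          (1 / 2 : ℝ) ^ ss c H T E i)) * (2 ^ (cl c i).card * 2 ^ ss c H T E i) := by
          rw [one_div, inv_pow, inv_pow]; field_simp
      _ ≤ 2 ^ f * (2 ^ (cl c i).card * 2 ^ ss c H T E i) := by gcongr
      _ = _ := by rw [pow_add, pow_add]; ring
  have h3 := (pow_le_pow_iff_right₀ (by norm_num : (1 : ℝ) < 2)).1 h2
  omega

lemma Pot_start {T E : Finset V} {φ : V → V} {η : ℝ} {m : ℕ} {I : Finset ι}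
    (hg : ∀ z, c z ∈ I → ∀ W ⊆ cl c (c z), η * (cl c (c z)).card ≤ W.card →
      Good c G H d E φ z W) : Pot c G H d η m T I E φ ≤ I.card := by
  unfold Pot
  have : ∀ i ∈ I, ∑ W ∈ (cl c i).powerset.filter (fun W => η * (cl c i).card ≤ W.card),
    (1 / 2 : ℝ) ^ (cl c i).card *
      (((2 : ℝ) ^ m) ^ bad c G H d T E φ i W * (1 / 2 : ℝ) ^ ss c H T E i) ≤ 1 := by
    intro i hi
    calc _ ≤ ∑ W ∈ (cl c i).powerset.filter (fun W => η * (cl c i).card ≤ W.card),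
          (1 / 2 : ℝ) ^ (cl c i).card := by
          refine sum_le_sum fun W hW => ?_
          rw [mem_filter, mem_powerset] at hW
          have hb : bad c G H d T E φ i W = 0 := by
            unfold bad
            rw [card_eq_zero, filter_eq_empty_iff]
            intro z hz
            rw [mem_inter, mem_cl] at hz
            obtain ⟨_, rfl⟩ := hz
            simpa using hg z hi W hW.1 hW.2
          rw [hb, pow_zero, one_mul]
          exact mul_le_of_le_one_right (by positivity) (pow_le_one₀ (by norm_num) (by norm_num))
      _ ≤ ∑ W ∈ (cl c i).powerset, (1 / 2 : ℝ) ^ (cl c i).card :=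
          sum_le_sum_of_subset_of_nonneg (filter_subset _ _) fun _ _ _ => by positivity
      _ = 1 := by
          rw [sum_const, card_powerset, nsmul_eq_mul]
          push_cast
          rw [← mul_pow]; norm_num
  calc _ ≤ ∑ i ∈ I, (1 : ℝ) := sum_le_sum this
    _ = I.card := by simp
end
end BlowUp


namespace BlowUp
open Finset
section
open scoped Classical
variable {V ι : Type*} [Fintype V]
variable {c : V → ι} {G H : SimpleGraph V} {D : ℕ} {d ε : ℝ}

lemma Av_step_adj {E : Finset V} {φ : V → V} {y u z : V} (hy : y ∉ E) (h : H.Adj y z) :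
    Av c G H (insert y E) (Function.update φ y u) z = nbr G u ∩ Av c G H E φ z := by
  unfold Av
  rw [Cand_step_adj hy h, image_step hy]
  ext v
  simp only [mem_sdiff, mem_inter, mem_insert, mem_nbr]
  constructor
  · rintro ⟨⟨h1, h2⟩, h3⟩; push Not at h3; exact ⟨h1, h2, h3.2⟩
  · rintro ⟨h1, h2, h3⟩
    refine ⟨⟨h1, h2⟩, ?_⟩
    rintro (rfl | h4)
    · exact G.loopless.irrefl _ h1
    · exact h3 h4

lemma Av_step_nadj {E : Finset V} {φ : V → V} {y u z : V} (hy : y ∉ E) (h : ¬ H.Adj y z) :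
    Av c G H (insert y E) (Function.update φ y u) z = (Av c G H E φ z).erase u := by
  unfold Av
  rw [Cand_step_nadj hy h, image_step hy]
  ext v
  simp only [mem_sdiff, mem_insert, mem_erase]
  tauto

lemma Av_step_subset {E : Finset V} {φ : V → V} {y u z : V} (hy : y ∉ E) :
    Av c G H (insert y E) (Function.update φ y u) z ⊆ Av c G H E φ z := by
  by_cases h : H.Adj y z
  · rw [Av_step_adj hy h]; exact inter_subset_right
  · rw [Av_step_nadj hy h]; exact erase_subset _ _

lemma card_free {E : Finset V} {φ : V → V} (hV : Valid c G H E φ) (i : ι) :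
    (cl c i \ E.image φ).card = (cl c i \ E).card := by
  have h1 : (cl c i ∩ E.image φ) = (cl c i ∩ E).image φ := by
    ext v
    simp only [mem_inter, mem_image, mem_cl]
    constructor
    · rintro ⟨h, a, ha, rfl⟩
      exact ⟨a, ⟨by rw [← hV.cls a ha]; exact h, ha⟩, rfl⟩
    · rintro ⟨a, ⟨h, ha⟩, rfl⟩
      exact ⟨by rw [hV.cls a ha]; exact h, a, ha, rfl⟩
  have h2 : (cl c i ∩ E.image φ).card = (cl c i ∩ E).card := by
    rw [h1, card_image_of_injOn]
    exact hV.inj.mono (by simp)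
  have h3 := card_sdiff_add_card_inter (cl c i) (E.image φ)
  have h4 := card_sdiff_add_card_inter (cl c i) E
  omega

/-- parameters used in the second phase -/
structure Par2 (D : ℕ) (d ε β γ η τ τ' : ℝ) (m : ℕ) : Prop where
  hβ : 0 < β
  hγ : 0 < γ
  hη : 0 < η
  hτ' : 0 < τ'
  hτ : τ = d ^ D * β / 2
  hγβ : γ ≤ β / 2
  hηβ : η ≤ β / 2
  hγτ : 2 * τ' + γ ≤ d ^ (D + 1) * τ
  hγη : γ + η ≤ τ
  hεη : ε ≤ d ^ D * η
  hετ : ε ≤ 2 * τ'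
  hM : ((2 : ℝ) ^ m) ^ D * D * ε ≤ τ'

/-- all facts about badness that the potential provides -/
def BadBound (c : V → ι) (G H : SimpleGraph V) (d γ η : ℝ) (m : ℕ) (T : Finset V)
    (I : Finset ι) (f : ℕ) : Prop :=
  ∀ E φ, Pot c G H d η m T I E φ ≤ f → ∀ i ∈ I, ∀ W ⊆ cl c i, η * (cl c i).card ≤ W.card →
    (((cl c i).filter (fun z => ¬ Good c G H d E φ z W)).card : ℝ) ≤ γ * (cl c i).card

/-- the invariant of the second phase -/
structure Inv (c : V → ι) (G H : SimpleGraph V) (d β γ η τ : ℝ) (m : ℕ) (T B : Finset V)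
    (I : Finset ι) (f : ℕ) (E : Finset V) (φ : V → V) (Qd : Finset V) : Prop where
  valid : Valid c G H E φ
  small : ∀ z, z ∉ E → c z ∈ I
  pot : Pot c G H d η m T I E φ ≤ f
  qb : ∀ x ∈ E, x ∈ B → x ∈ Qd
  nbB : ∀ b ∈ B, ∀ y, H.Adj b y → y ∈ E
  q1 : ∀ z, z ∉ E → z ∉ Qd → τ * (cl c (c z)).card ≤ (Av c G H E φ z).card
  q2 : ∀ z, z ∉ E → z ∈ Qd → d ^ (kk H E z + 1) * τ * (cl c (c z)).card ≤
    (Av c G H E φ z).card + ((E ∩ Qd ∩ cl c (c z)).card : ℝ)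
  q3 : ∀ z ∈ Qd, ((Av c G H E φ z).card : ℝ) < τ * (cl c (c z)).card
  q4 : ∀ i ∈ I, ((Qd ∩ cl c i).card : ℝ) ≤ γ * (cl c i).card
  cc : ∀ v, v ∉ E.image φ → c v ∈ I → τ * (cl c (c v)).card ≤
    (((B ∩ cl c (c v)).filter (fun b => v ∈ Cand c G H E φ b)).card : ℝ)

variable {β γ η τ τ' : ℝ} {m f : ℕ} {T B : Finset V} {I : Finset ι} {E Qd : Finset V} {φ : V → V}

lemma Inv.Av_big (hS : Setup c G H D d ε) (hp : Par2 D d ε β γ η τ τ' m)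
    (h : Inv c G H d β γ η τ m T B I f E φ Qd) {z : V} (hz : z ∉ E) :
    2 * τ' * (cl c (c z)).card ≤ (Av c G H E φ z).card := by
  have hd1 : d ≤ 1 := by linarith [hS.hd2]
  have hd := hS.hd
  have hτ : 0 < τ := by rw [hp.hτ]; have := hp.hβ; positivity
  have hn : (0 : ℝ) ≤ (cl c (c z)).card := by positivity
  by_cases hq : z ∈ Qd
  · have h1 := h.q2 z hz hq
    have h2 : ((E ∩ Qd ∩ cl c (c z)).card : ℝ) ≤ γ * (cl c (c z)).card := by
      refine le_trans ?_ (h.q4 _ (h.small z hz))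
      exact_mod_cast card_le_card (inter_subset_inter_right inter_subset_right)
    have h3 : d ^ (D + 1) ≤ d ^ (kk H E z + 1) :=
      pow_le_pow_of_le_one hd.le hd1 (by have := kk_le hS E z; omega)
    have h4 : d ^ (D + 1) * τ * (cl c (c z)).card ≤ d ^ (kk H E z + 1) * τ * (cl c (c z)).card := by
      gcongr
    have h5 := mul_le_mul_of_nonneg_right hp.hγτ hn
    linarith
  · refine le_trans ?_ (h.q1 z hz hq)
    have h3 : d ^ (D + 1) ≤ 1 := pow_le_one₀ hd.le hd1
    have : 2 * τ' ≤ τ := by nlinarith [hp.hγτ, hp.hγ]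
    gcongr

lemma Inv.next (hS : Setup c G H D d ε) (hp : Par2 D d ε β γ η τ τ' m)
    (hbb : BadBound c G H d γ η m T I f)
    (hBs : ∀ i ∈ I, β * (cl c i).card ≤ ((B ∩ cl c i).card : ℝ))
    (hN : ∀ i ∈ I, 2 ≤ τ * (cl c i).card)
    (h : Inv c G H d β γ η τ m T B I f E φ Qd) {y : V} (hy : y ∉ E)
    (hyq : y ∈ Qd ∨ (y ∉ B ∧ Qd ⊆ E)) :
    ∃ u Qd', Inv c G H d β γ η τ m T B I f (insert y E) (Function.update φ y u) Qd' := by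
  have hd1 : d ≤ 1 := by linarith [hS.hd2]
  have hd := hS.hd
  have hτ : 0 < τ := by rw [hp.hτ]; have := hp.hβ; positivity
  obtain ⟨u, hu, huY, hpot⟩ := step hS (T := T) (m := m) hy I hp.hεη hp.hτ' hp.hM (h.Av_big hS hp hy)
    (fun z => Av c G H E φ z) (fun z hz _ => ⟨Av_subset, by
      refine le_trans ?_ (h.Av_big hS hp hz)
      have := hp.hετ
      gcongr⟩)
  have hcu : c u = c y := mem_cl.1 (Av_subset hu)
  set E' := insert y E with hE'
  set φ' := Function.update φ y u with hφ'
  have hv' : Valid c G H E' φ' := h.valid.step hy hu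
  refine ⟨u, Qd ∪ univ.filter (fun z => z ∉ E' ∧
    ((Av c G H E' φ' z).card : ℝ) < τ * (cl c (c z)).card), ?_⟩
  set Qd' := Qd ∪ univ.filter (fun z => z ∉ E' ∧
    ((Av c G H E' φ' z).card : ℝ) < τ * (cl c (c z)).card) with hQd'
  have hE'mem : ∀ z, z ∉ E' → z ∉ E := fun z hz hz' => hz (mem_insert_of_mem hz')
  have hpot' : Pot c G H d η m T I E' φ' ≤ f := hpot.trans h.pot
  have q3' : ∀ z ∈ Qd', ((Av c G H E' φ' z).card : ℝ) < τ * (cl c (c z)).card := by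
    intro z hz
    rcases mem_union.1 hz with hz | hz
    · refine lt_of_le_of_lt ?_ (h.q3 z hz)
      exact_mod_cast card_le_card (Av_step_subset hy)
    · exact (mem_filter.1 hz).2.2
  have hqb' : ∀ x ∈ E', x ∈ B → x ∈ Qd := by
    intro x hx hxB
    rcases mem_insert.1 hx with rfl | hx
    · rcases hyq with hq | hq
      · exact hq
      · exact absurd hxB hq.1
    · exact h.qb x hx hxB
  refine ⟨hv', fun z hz => h.small z (hE'mem z hz), hpot', ?_, ?_, ?_, ?_, q3', ?_, ?_⟩
  · exact fun x hx hxB => mem_union_left _ (hqb' x hx hxB)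
  · exact fun b hb z hz => mem_insert_of_mem (h.nbB b hb z hz)
  · intro z hz hzq
    by_contra hcon
    push Not at hcon
    exact hzq (mem_union_right _ (mem_filter.2 ⟨mem_univ _, hz, hcon⟩))
  · intro z hz hzq
    have hzE := hE'mem z hz
    have hzy : z ≠ y := by rintro rfl; exact hz (mem_insert_self _ _)
    have hn : (0 : ℝ) ≤ (cl c (c z)).card := by positivity
    have hcnt : ((E ∩ Qd ∩ cl c (c z)).card : ℝ) ≤ (E' ∩ Qd' ∩ cl c (c z)).card := by
      refine Nat.cast_le.2 (card_le_card ?_)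
      gcongr
      · exact subset_insert _ _
      · exact subset_union_left
    by_cases hzQ : z ∈ Qd
    · have h1 := h.q2 z hzE hzQ
      have hyQ : y ∈ Qd := by
        rcases hyq with hq | hq
        · exact hq
        · exact absurd (hq.2 hzQ) hzE
      by_cases hadj : H.Adj y z
      · have h2 := huY z hzE hadj
        rw [kk_step_adj hy hadj, Av_step_adj hy hadj, pow_succ]
        have h0 : (0 : ℝ) ≤ (E ∩ Qd ∩ cl c (c z)).card := by positivity
        have h3 := mul_le_mul_of_nonneg_left h1 hd.le
        nlinarith
      · rw [kk_step_nadj hadj, Av_step_nadj hy hadj]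
        by_cases hcc : c z = c y
        · have h3 : ((E ∩ Qd ∩ cl c (c z)).card : ℝ) + 1 ≤ (E' ∩ Qd' ∩ cl c (c z)).card := by
            have : insert y (E ∩ Qd ∩ cl c (c z)) ⊆ E' ∩ Qd' ∩ cl c (c z) := by
              intro x hx
              rcases mem_insert.1 hx with rfl | hx
              · simp [hE', hQd', hyQ, hcc]
              · simp only [mem_inter] at hx ⊢
                exact ⟨⟨mem_insert_of_mem hx.1.1, mem_union_left _ hx.1.2⟩, hx.2⟩
            have h4 := card_le_card this
            rw [card_insert_of_notMem (by simp [hy])] at h4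
            exact_mod_cast h4
          have h4 : ((Av c G H E φ z).card : ℝ) ≤ ((Av c G H E φ z).erase u).card + 1 := by
            have h9 := pred_card_le_card_erase (s := Av c G H E φ z) (a := u)
            have h10 : (Av c G H E φ z).card ≤ ((Av c G H E φ z).erase u).card + 1 := by omega
            exact_mod_cast h10
          linarith
        · rw [erase_eq_of_notMem (fun hu' => hcc (by rw [← hcu]; exact (mem_cl.1 (Av_subset hu')).symm))]
          linarith
    · have h1 := h.q1 z hzE hzQ
      have h0 : (0 : ℝ) ≤ (E' ∩ Qd' ∩ cl c (c z)).card := by positivity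
      have hdk : d ^ (kk H E' z + 1) ≤ d := by
        rw [pow_succ]
        exact mul_le_of_le_one_left hd.le (pow_le_one₀ hd.le hd1)
      have h2 : d ^ (kk H E' z + 1) * τ * (cl c (c z)).card ≤ d * τ * (cl c (c z)).card := by
        gcongr
      suffices d * τ * (cl c (c z)).card ≤ ((Av c G H E' φ' z).card : ℝ) by linarith
      by_cases hadj : H.Adj y z
      · have h2 := huY z hzE hadj
        rw [Av_step_adj hy hadj]
        nlinarith
      · rw [Av_step_nadj hy hadj]
        have h4 : ((Av c G H E φ z).card : ℝ) ≤ ((Av c G H E φ z).erase u).card + 1 := by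
            have h9 := pred_card_le_card_erase (s := Av c G H E φ z) (a := u)
            have h10 : (Av c G H E φ z).card ≤ ((Av c G H E φ z).erase u).card + 1 := by omega
            exact_mod_cast h10
        have h5 := hN _ (h.small z hzE)
        have := hS.hd2
        nlinarith
  · intro i hi
    set W := cl c i \ E'.image φ' with hW
    have hn : (0 : ℝ) ≤ (cl c i).card := by positivity
    have hWc : (β / 2) * (cl c i).card ≤ W.card := by
      rw [hW, card_free hv']
      have h1 : B ∩ cl c i ⊆ (cl c i \ E') ∪ (Qd ∩ cl c i) := by
        intro b hb
        rw [mem_inter] at hb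
        by_cases hbE : b ∈ E'
        · exact mem_union_right _ (mem_inter.2 ⟨hqb' b hbE hb.1, hb.2⟩)
        · exact mem_union_left _ (mem_sdiff.2 ⟨hb.2, hbE⟩)
      have h2 := (card_le_card h1).trans (card_union_le _ _)
      have h3 : ((B ∩ cl c i).card : ℝ) ≤ (cl c i \ E').card + (Qd ∩ cl c i).card := by
        exact_mod_cast h2
      have h4 := h.q4 i hi
      have h5 := hBs i hi
      have := hp.hγβ
      nlinarith
    have hb := hbb E' φ' hpot' i hi W sdiff_subset (by
      refine le_trans ?_ hWc
      have := hp.hηβ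
      gcongr)
    refine le_trans ?_ hb
    refine Nat.cast_le.2 (card_le_card ?_)
    intro z hz
    rw [mem_inter] at hz
    refine mem_filter.2 ⟨hz.2, ?_⟩
    unfold Good
    push Not
    have hcz : c z = i := mem_cl.1 hz.2
    have hCW : Cand c G H E' φ' z ∩ W = Av c G H E' φ' z := by
      unfold Av
      ext v
      simp only [mem_inter, mem_sdiff, hW, mem_cl]
      constructor
      · tauto
      · rintro ⟨h1, h2⟩
        exact ⟨h1, by rw [← hcz]; exact mem_cl.1 (Cand_subset h1), h2⟩
    rw [hCW]
    refine lt_of_lt_of_le (q3' z hz.1) ?_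
    rw [hcz, hp.hτ]
    have h3 : d ^ D ≤ d ^ (kk H E' z) := pow_le_pow_of_le_one hd.le hd1 (kk_le hS E' z)
    calc d ^ D * β / 2 * (cl c i).card = d ^ D * ((β / 2) * (cl c i).card) := by ring
      _ ≤ d ^ D * W.card := by gcongr
      _ ≤ _ := by gcongr
  · intro v hv hvI
    rw [image_step hy] at hv
    refine (h.cc v (fun hv' => hv (mem_insert_of_mem hv')) hvI).trans ?_
    refine Nat.cast_le.2 (card_le_card ?_)
    intro b hb
    rw [mem_filter] at hb ⊢
    refine ⟨hb.1, ?_⟩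
    rw [Cand_step_nadj hy]
    · exact hb.2
    · intro hadj
      exact hy (h.nbB b (mem_inter.1 hb.1).1 y hadj.symm)

lemma Inv.finish (hS : Setup c G H D d ε) (hp : Par2 D d ε β γ η τ τ' m)
    (hbb : BadBound c G H d γ η m T I f)
    (h : Inv c G H d β γ η τ m T B I f E φ Qd)
    (hE : ∀ z, z ∉ E → z ∈ B ∧ z ∉ Qd) :
    ∃ ψ : V → V, Function.Injective ψ ∧ ∀ x y, H.Adj x y → G.Adj (ψ x) (ψ y) := by
  have hd := hS.hd
  have hhall : ∀ i, ∃ g : {x // x ∈ cl c i \ E} → V, Function.Injective g ∧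
      ∀ x, g x ∈ Av c G H E φ x.1 := by
    intro i
    refine (Finset.all_card_le_biUnion_card_iff_exists_injective
      (fun x : {x // x ∈ cl c i \ E} => Av c G H E φ x.1)).1 ?_
    intro s
    by_contra hcon
    push Not at hcon
    set Nn := s.biUnion (fun x : {x // x ∈ cl c i \ E} => Av c G H E φ x.1) with hNn
    have hsne : s.Nonempty := card_pos.1 (lt_of_le_of_lt (Nat.zero_le _) hcon)
    obtain ⟨x0, hx0⟩ := hsne
    have hx0' := mem_sdiff.1 x0.2
    have hcx0 : c x0.1 = i := mem_cl.1 hx0'.1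
    have hi : i ∈ I := by rw [← hcx0]; exact h.small _ hx0'.2
    have hn : (0 : ℝ) < (cl c i).card := by
      exact_mod_cast card_pos.2 ⟨x0.1, hx0'.1⟩
    have hA : τ * (cl c i).card ≤ (Nn.card : ℝ) := by
      have h1 := h.q1 x0.1 hx0'.2 (hE _ hx0'.2).2
      rw [hcx0] at h1
      refine h1.trans (Nat.cast_le.2 (card_le_card ?_))
      exact subset_biUnion_of_mem (fun x : {x // x ∈ cl c i \ E} => Av c G H E φ x.1) hx0
    set S : Finset V := s.map (Function.Embedding.subtype _) with hSdef
    have hScard : S.card = s.card := card_map _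
    have hSsub : S ⊆ cl c i \ E := by
      intro x hx
      rw [hSdef, mem_map] at hx
      obtain ⟨a, _, rfl⟩ := hx
      exact a.2
    have hNS : ∀ x ∈ S, Av c G H E φ x ⊆ Nn := by
      intro x hx
      rw [hSdef, mem_map] at hx
      obtain ⟨a, ha, rfl⟩ := hx
      exact subset_biUnion_of_mem (fun x : {x // x ∈ cl c i \ E} => Av c G H E φ x.1) ha
    set W := (cl c i \ E.image φ) \ Nn with hW
    have hWsub : W ⊆ cl c i := sdiff_subset.trans sdiff_subset
    have hNsub : Nn ⊆ cl c i \ E.image φ := by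
      intro v hv
      rw [hNn, mem_biUnion] at hv
      obtain ⟨x, _, hx⟩ := hv
      refine mem_sdiff.2 ⟨?_, (mem_sdiff.1 hx).2⟩
      have h1 := Av_subset hx
      rwa [mem_cl.1 (mem_sdiff.1 x.2).1] at h1
    have hWc : W.card + Nn.card = (cl c i \ E).card := by
      rw [← card_free h.valid, hW]
      exact card_sdiff_add_card_eq_card hNsub
    have hSc : ((cl c i \ E) \ S).card + S.card = (cl c i \ E).card :=
      card_sdiff_add_card_eq_card hSsub
    have hWpos : 0 < W.card := by omega
    obtain ⟨v, hv⟩ := card_pos.1 hWpos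
    have hvv := mem_sdiff.1 hv
    have hvc : c v = i := mem_cl.1 (hWsub hv)
    have hcc := h.cc v (mem_sdiff.1 hvv.1).2 (by rw [hvc]; exact hi)
    rw [hvc] at hcc
    have hsub : (B ∩ cl c i).filter (fun b => v ∈ Cand c G H E φ b) ⊆
        ((cl c i \ E) \ S) ∪ (Qd ∩ cl c i) := by
      intro b hb
      rw [mem_filter, mem_inter] at hb
      obtain ⟨⟨hbB, hbi⟩, hbv⟩ := hb
      by_cases hbE : b ∈ E
      · exact mem_union_right _ (mem_inter.2 ⟨h.qb b hbE hbB, hbi⟩)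
      · refine mem_union_left _ (mem_sdiff.2 ⟨mem_sdiff.2 ⟨hbi, hbE⟩, fun hbS => ?_⟩)
        exact hvv.2 (hNS b hbS (mem_Av.2 ⟨hbv, (mem_sdiff.1 hvv.1).2⟩))
    have h2 : (((B ∩ cl c i).filter (fun b => v ∈ Cand c G H E φ b)).card : ℝ) ≤
        ((cl c i \ E) \ S).card + (Qd ∩ cl c i).card := by
      exact_mod_cast (card_le_card hsub).trans (card_union_le _ _)
    have h3 := h.q4 i hi
    have h4 : (((cl c i \ E) \ S).card : ℝ) ≤ W.card := by
      have : ((cl c i \ E) \ S).card ≤ W.card := by omega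
      exact_mod_cast this
    have hWη : η * (cl c i).card ≤ W.card := by
      have := mul_le_mul_of_nonneg_right hp.hγη hn.le
      linarith
    have hb := hbb E φ h.pot i hi W hWsub hWη
    have hSb : S ⊆ (cl c i).filter (fun z => ¬ Good c G H d E φ z W) := by
      intro x hx
      refine mem_filter.2 ⟨(mem_sdiff.1 (hSsub hx)).1, ?_⟩
      unfold Good
      push Not
      have : Cand c G H E φ x ∩ W = ∅ := by
        rw [eq_empty_iff_forall_notMem]
        intro w hw
        rw [mem_inter] at hw
        have hww := mem_sdiff.1 hw.2
        exact hww.2 (hNS x hx (mem_Av.2 ⟨hw.1, (mem_sdiff.1 hww.1).2⟩))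
      rw [this]
      have : (0 : ℝ) < W.card := by exact_mod_cast hWpos
      simp only [card_empty, Nat.cast_zero]
      positivity
    have h5 : (S.card : ℝ) ≤ γ * (cl c i).card :=
      (Nat.cast_le.2 (card_le_card hSb)).trans hb
    have h6 : (Nn.card : ℝ) < S.card := by rw [hScard]; exact_mod_cast hcon
    have h7 : γ * (cl c i).card ≤ τ * (cl c i).card := by
      have := hp.hγη
      have := hp.hη
      gcongr
      linarith
    linarith
  choose g hg1 hg2 using hhall
  have hmem : ∀ x, x ∉ E → x ∈ cl c (c x) \ E := fun x hx => by simp [hx]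
  set ψ : V → V := fun x => if hx : x ∈ E then φ x else g (c x) ⟨x, hmem x hx⟩ with hψ
  have hψ1 : ∀ x ∈ E, ψ x = φ x := fun x hx => by simp [hψ, hx]
  have hψ2 : ∀ x (hx : x ∉ E), ψ x = g (c x) ⟨x, hmem x hx⟩ := fun x hx => by simp [hψ, hx]
  have hψA : ∀ x, x ∉ E → ψ x ∈ Av c G H E φ x := fun x hx => by
    rw [hψ2 x hx]; exact hg2 (c x) ⟨x, hmem x hx⟩
  have hψc : ∀ x, c (ψ x) = c x := by
    intro x
    by_cases hx : x ∈ E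
    · rw [hψ1 x hx]; exact h.valid.cls x hx
    · exact mem_cl.1 (Av_subset (hψA x hx))
  have hmix : ∀ x y, x ∉ E → y ∈ E → H.Adj y x → G.Adj (ψ y) (ψ x) := by
    intro x y hx hy hxy
    have h1 := (mem_Cand.1 (mem_Av.1 (hψA x hx)).1).2 y hy hxy
    rwa [hψ1 y hy]
  refine ⟨ψ, ?_, ?_⟩
  · intro x y hxy
    have hcxy : c x = c y := by rw [← hψc x, ← hψc y, hxy]
    by_cases hx : x ∈ E <;> by_cases hy : y ∈ E
    · rw [hψ1 x hx, hψ1 y hy] at hxy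
      exact h.valid.inj hx hy hxy
    · exfalso
      apply (mem_Av.1 (hψA y hy)).2
      rw [← hxy, hψ1 x hx]
      exact mem_image_of_mem _ hx
    · exfalso
      apply (mem_Av.1 (hψA x hx)).2
      rw [hxy, hψ1 y hy]
      exact mem_image_of_mem _ hy
    · have key : ∀ i (hxi : x ∈ cl c i \ E) (hyi : y ∈ cl c i \ E),
          g i ⟨x, hxi⟩ = g i ⟨y, hyi⟩ → x = y := by
        intro i hxi hyi he
        simpa using hg1 i he
      have e2 : ψ y = g (c x) ⟨y, by rw [hcxy]; exact hmem y hy⟩ := by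
        rw [hψ2 y hy]
        have key2 : ∀ i j (_ : i = j) (hi : y ∈ cl c i \ E) (hj : y ∈ cl c j \ E),
            g i ⟨y, hi⟩ = g j ⟨y, hj⟩ := by
          rintro i j rfl hi hj; rfl
        exact key2 _ _ hcxy.symm _ _
      rw [hψ2 x hx, e2] at hxy
      exact key _ _ _ hxy
  · intro x y hxy
    by_cases hx : x ∈ E <;> by_cases hy : y ∈ E
    · rw [hψ1 x hx, hψ1 y hy]; exact h.valid.adj x hx y hy hxy
    · exact hmix y x hy hx hxy
    · exact (hmix x y hx hy hxy.symm).symm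
    · exact absurd (h.nbB x (hE x hx).1 y hxy) hy

lemma Inv.exists (hS : Setup c G H D d ε) (hp : Par2 D d ε β γ η τ τ' m)
    (hbb : BadBound c G H d γ η m T I f)
    (hBs : ∀ i ∈ I, β * (cl c i).card ≤ ((B ∩ cl c i).card : ℝ))
    (hN : ∀ i ∈ I, 2 ≤ τ * (cl c i).card)
    (h : Inv c G H d β γ η τ m T B I f E φ Qd) :
    ∃ ψ : V → V, Function.Injective ψ ∧ ∀ x y, H.Adj x y → G.Adj (ψ x) (ψ y) := by
  obtain ⟨k, hk⟩ : ∃ k, (Eᶜ).card = k := ⟨_, rfl⟩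
  induction k generalizing E φ Qd with
  | zero =>
    refine h.finish hS hp hbb fun z hz => ?_
    rw [card_eq_zero] at hk
    exact absurd (mem_compl.2 hz) (by simp [hk])
  | succ k ih =>
    have hcard : ∀ y, y ∉ E → ((insert y E)ᶜ).card = k := by
      intro y hy
      rw [compl_insert, card_erase_of_mem (mem_compl.2 hy), hk]; rfl
    by_cases h1 : ∃ y, y ∉ E ∧ y ∈ Qd
    · obtain ⟨y, hy, hyq⟩ := h1
      obtain ⟨u, Qd', h'⟩ := h.next hS hp hbb hBs hN hy (Or.inl hyq)
      exact ih h' (hcard y hy)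
    · push Not at h1
      by_cases h2 : ∃ y, y ∉ E ∧ y ∉ B
      · obtain ⟨y, hy, hyB⟩ := h2
        obtain ⟨u, Qd', h'⟩ := h.next hS hp hbb hBs hN hy
          (Or.inr ⟨hyB, fun z hz => by by_contra hzE; exact h1 z hzE hz⟩)
        exact ih h' (hcard y hy)
      · push Not at h2
        exact h.finish hS hp hbb fun z hz => ⟨h2 z hz, h1 z hz⟩
end
end BlowUp

set_option linter.unusedSectionVars false

namespace BlowUp
open Finset
section
open scoped Classical
variable {V ι : Type*} [Fintype V]
variable {c : V → ι} {G H : SimpleGraph V} {D : ℕ} {d ε : ℝ}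

/-- distance at most three -/
def near (H : SimpleGraph V) (x y : V) : Prop :=
  ∃ a b, (x = a ∨ H.Adj x a) ∧ (a = b ∨ H.Adj a b) ∧ (b = y ∨ H.Adj b y)

lemma near_symm {x y : V} (h : near H x y) : near H y x := by
  obtain ⟨a, b, h1, h2, h3⟩ := h
  exact ⟨b, a, h3.imp Eq.symm SimpleGraph.Adj.symm, h2.imp Eq.symm SimpleGraph.Adj.symm,
    h1.imp Eq.symm SimpleGraph.Adj.symm⟩

lemma near_card (hdeg : ∀ x, (nbr H x).card ≤ D) (x : V) :
    (univ.filter (fun y => near H x y)).card ≤ (D + 1) ^ 3 := by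
  have h1 : ∀ x, (insert x (nbr H x)).card ≤ D + 1 := fun x =>
    (card_insert_le _ _).trans (by have := hdeg x; omega)
  have h2 : univ.filter (fun y => near H x y) ⊆
      (insert x (nbr H x)).biUnion fun a => (insert a (nbr H a)).biUnion fun b =>
        insert b (nbr H b) := by
    intro y hy
    obtain ⟨a, b, h1, h2, h3⟩ := (mem_filter.1 hy).2
    simp only [mem_biUnion, mem_insert, mem_nbr]
    exact ⟨a, h1.imp Eq.symm id, b, h2.imp Eq.symm id, h3.imp Eq.symm id⟩
  refine (card_le_card h2).trans ?_
  have h3 : ∀ a, ((insert a (nbr H a)).biUnion fun b => insert b (nbr H b)).card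
      ≤ (D + 1) * (D + 1) := fun a =>
    (card_biUnion_le_card_mul _ _ (D + 1) fun b _ => h1 b).trans
      (Nat.mul_le_mul_right _ (h1 a))
  refine (card_biUnion_le_card_mul _ _ _ fun a _ => h3 a).trans ?_
  calc _ ≤ (D + 1) * ((D + 1) * (D + 1)) := Nat.mul_le_mul_right _ (h1 x)
    _ = _ := by ring

lemma select (hdeg : ∀ x, (nbr H x).card ≤ D) (t : ι → ℕ) (P : V → Prop) (I : Finset ι)
    (hsum : ∀ i ∈ I, ((cl c i).filter (fun x => ¬ P x)).card +
      (D + 1) ^ 3 * ∑ j ∈ I.filter (fun j => (cl c j).card ≤ (cl c i).card), t j ≤ (cl c i).card) :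
    ∃ S : Finset V, (∀ x ∈ S, P x ∧ c x ∈ I) ∧ (∀ x ∈ S, ∀ y ∈ S, x ≠ y → ¬ near H x y) ∧
      ∀ i ∈ I, (S ∩ cl c i).card = t i := by
  induction I using Finset.induction_on_max_value (fun i => (cl c i).card) with
  | empty => exact ⟨∅, by simp, by simp, by simp⟩
  | insert a s has hmax ih =>
    obtain ⟨S, hS1, hS2, hS3⟩ := ih (by
      intro i hi
      refine le_trans ?_ (hsum i (mem_insert_of_mem hi))
      gcongr
      exact subset_insert _ _)
    have hScard : S.card = ∑ j ∈ s, t j := by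
      rw [card_eq_sum_card_fiberwise (f := c) (t := s) (fun x hx => (hS1 x hx).2)]
      refine sum_congr rfl fun j hj => ?_
      rw [← hS3 j hj]
      congr 1
      ext x; simp
    have hsa := hsum a (mem_insert_self _ _)
    rw [filter_true_of_mem (s := insert a s) (p := fun j => (cl c j).card ≤ (cl c a).card) (by
      intro j hj
      rcases mem_insert.1 hj with rfl | hj
      · exact le_rfl
      · exact hmax j hj), sum_insert has, ← hScard] at hsa
    have inner : ∀ r ≤ t a, ∃ S' : Finset V, (∀ x ∈ S', P x ∧ c x ∈ insert a s) ∧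
        (∀ x ∈ S', ∀ y ∈ S', x ≠ y → ¬ near H x y) ∧
        (∀ i ∈ s, (S' ∩ cl c i).card = t i) ∧ (S' ∩ cl c a).card = r ∧ S'.card = S.card + r := by
      intro r
      induction r with
      | zero =>
        intro _
        refine ⟨S, fun x hx => ⟨(hS1 x hx).1, mem_insert_of_mem (hS1 x hx).2⟩, hS2, hS3, ?_, rfl⟩
        rw [card_eq_zero, eq_empty_iff_forall_notMem]
        intro x hx
        rw [mem_inter, mem_cl] at hx
        exact has (hx.2 ▸ (hS1 x hx.1).2)
      | succ r ihr =>
        intro hr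
        obtain ⟨S', h1, h2, h3, h4, h5⟩ := ihr (by omega)
        have hex : ∃ x ∈ cl c a, x ∉ (cl c a).filter (fun x => ¬ P x) ∪
            S'.biUnion (fun x => univ.filter (fun y => near H x y)) := by
          by_contra hcon
          push Not at hcon
          have h6 := card_le_card (show cl c a ⊆ _ from hcon)
          have h7 := h6.trans (card_union_le _ _)
          have h8 := card_biUnion_le_card_mul S' (fun x => univ.filter (fun y => near H x y)) _
            (fun x _ => near_card hdeg x)
          have h9 : S'.card * (D + 1) ^ 3 < (D + 1) ^ 3 * (t a + S.card) := by
            rw [mul_comm]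
            apply Nat.mul_lt_mul_of_pos_left
            · omega
            · positivity
          omega
        obtain ⟨x, hxa, hx⟩ := hex
        simp only [mem_union, mem_filter, mem_biUnion, mem_univ, true_and, not_or, not_and,
          not_not, not_exists] at hx
        obtain ⟨hxP, hxn⟩ := hx
        have hxS : x ∉ S' := fun hxS => hxn x hxS ⟨x, x, Or.inl rfl, Or.inl rfl, Or.inl rfl⟩
        refine ⟨insert x S', ?_, ?_, ?_, ?_, ?_⟩
        · intro y hy
          rcases mem_insert.1 hy with rfl | hy
          · exact ⟨hxP hxa, by rw [mem_cl.1 hxa]; exact mem_insert_self _ _⟩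
          · exact h1 y hy
        · intro y hy z hz hyz
          rcases mem_insert.1 hy with hy' | hy' <;> rcases mem_insert.1 hz with hz' | hz'
          · exact absurd (hy'.trans hz'.symm) hyz
          · exact fun hn => hxn z hz' (near_symm (hy' ▸ hn))
          · exact fun hn => hxn y hy' (hz' ▸ hn)
          · exact h2 y hy' z hz' hyz
        · intro i hi
          rw [← h3 i hi, insert_inter_of_notMem]
          intro hxi
          rw [mem_cl] at hxi hxa
          exact has (hxa ▸ hxi ▸ hi)
        · rw [insert_inter_of_mem hxa, card_insert_of_notMem (by simp [hxS]), h4]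
        · rw [card_insert_of_notMem hxS, h5]; ring
    obtain ⟨S', h1, h2, h3, h4, _⟩ := inner (t a) le_rfl
    refine ⟨S', h1, h2, fun i hi => ?_⟩
    rcases mem_insert.1 hi with rfl | hi
    · exact h4
    · exact h3 i hi

/-- the ratio rule -/
def Rule (c : V → ι) (H : SimpleGraph V) (κ : ℝ) (x : V) : Prop :=
  ∀ y, H.Adj x y → κ * (cl c (c x)).card ≤ (cl c (c y)).card

lemma rule_card [Fintype ι] (hdeg : ∀ x, (nbr H x).card ≤ D) {κ : ℝ} (i : ι) (hκ : 0 ≤ κ) :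
    (((cl c i).filter (fun x => ¬ Rule c H κ x)).card : ℝ) ≤
      Fintype.card ι * D * κ * (cl c i).card := by
  set J := (univ : Finset ι).filter (fun j => ((cl c j).card : ℝ) < κ * (cl c i).card) with hJ
  have h1 : (cl c i).filter (fun x => ¬ Rule c H κ x) ⊆
      (J.biUnion fun j => cl c j).biUnion fun y => nbr H y := by
    intro x hx
    rw [mem_filter, mem_cl] at hx
    obtain ⟨hxi, hx⟩ := hx
    unfold Rule at hx
    push Not at hx
    obtain ⟨y, hxy, hy⟩ := hx
    rw [mem_biUnion]
    refine ⟨y, mem_biUnion.2 ⟨c y, ?_, by simp⟩, by simpa using hxy.symm⟩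
    rw [hJ, mem_filter]
    exact ⟨mem_univ _, by rwa [hxi] at hy⟩
  have h2 : (((J.biUnion fun j => cl c j).card : ℕ) : ℝ) ≤
      Fintype.card ι * (κ * (cl c i).card) := by
    have : (((J.biUnion fun j => cl c j).card : ℕ) : ℝ) ≤ ∑ j ∈ J, ((cl c j).card : ℝ) := by
      exact_mod_cast card_biUnion_le
    refine this.trans ?_
    calc _ ≤ ∑ j ∈ J, κ * ((cl c i).card : ℝ) :=
          sum_le_sum fun j hj => (mem_filter.1 hj).2.le
      _ = J.card * (κ * (cl c i).card) := by rw [sum_const, nsmul_eq_mul]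
      _ ≤ _ := by
        gcongr
        exact card_le_univ _
  have h3 := (card_le_card h1).trans (card_biUnion_le_card_mul _ _ D fun y _ => hdeg y)
  calc _ ≤ ((J.biUnion fun j => cl c j).card : ℝ) * D := by exact_mod_cast h3
    _ ≤ (Fintype.card ι * (κ * (cl c i).card)) * D := by gcongr
    _ = _ := by ring

lemma nb_card [Fintype ι] (hdeg : ∀ x, (nbr H x).card ≤ D) {κ ρ : ℝ} (hκ : 0 < κ) (hρ : 0 ≤ ρ)
    {S : Finset V} (hR : ∀ x ∈ S, Rule c H κ x)
    (hS : ∀ x ∈ S, ((S ∩ cl c (c x)).card : ℝ) ≤ ρ * (cl c (c x)).card) (j : ι) :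
    (((cl c j).filter (fun y => ∃ x ∈ S, H.Adj x y)).card : ℝ) ≤
      D * Fintype.card ι * ρ / κ * (cl c j).card := by
  set S' := S.filter (fun x => κ * (cl c (c x)).card ≤ (cl c j).card) with hS'
  have h1 : (cl c j).filter (fun y => ∃ x ∈ S, H.Adj x y) ⊆ S'.biUnion fun x => nbr H x := by
    intro y hy
    rw [mem_filter, mem_cl] at hy
    obtain ⟨rfl, x, hx, hxy⟩ := hy
    exact mem_biUnion.2 ⟨x, mem_filter.2 ⟨hx, hR x hx y hxy⟩, by simpa using hxy⟩
  have h2 : (S'.card : ℝ) ≤ Fintype.card ι * (ρ / κ * (cl c j).card) := by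
    rw [card_eq_sum_card_fiberwise (f := c) (t := univ) (fun x _ => by simp)]
    push_cast
    calc _ ≤ ∑ i : ι, (ρ / κ * (cl c j).card : ℝ) := by
          refine sum_le_sum fun i _ => ?_
          rcases (S'.filter (fun a => c a = i)).eq_empty_or_nonempty with h0 | ⟨x, hx⟩
          · rw [h0, card_empty]; push_cast; positivity
          · rw [mem_filter, hS', mem_filter] at hx
            obtain ⟨⟨hxS, hxk⟩, rfl⟩ := hx
            have h3 : ((S'.filter (fun a => c a = c x)).card : ℝ) ≤ (S ∩ cl c (c x)).card := by
              refine Nat.cast_le.2 (card_le_card ?_)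
              intro y hy
              simp only [hS', mem_filter, mem_inter, mem_cl] at hy ⊢
              exact ⟨hy.1.1, hy.2⟩
            refine h3.trans ((hS x hxS).trans ?_)
            rw [div_mul_eq_mul_div, le_div_iff₀ hκ]
            nlinarith
      _ = _ := by rw [sum_const, nsmul_eq_mul]; simp
  have h3 := (card_le_card h1).trans (card_biUnion_le_card_mul _ _ D fun y _ => hdeg y)
  calc _ ≤ (S'.card : ℝ) * D := by exact_mod_cast h3
    _ ≤ (Fintype.card ι * (ρ / κ * (cl c j).card)) * D := by gcongr
    _ = _ := by ring

/-- splitting a set class by class -/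
lemma split {S : Finset V} {I : Finset ι} {t1 t2 : ι → ℕ}
    (hS : ∀ i ∈ I, (S ∩ cl c i).card = t1 i + t2 i) :
    ∃ B R : Finset V, B ⊆ S ∧ R ⊆ S ∧ Disjoint B R ∧
      (∀ i ∈ I, (B ∩ cl c i).card = t1 i) ∧ (∀ i ∈ I, (R ∩ cl c i).card = t2 i) := by
  have : ∀ i, ∃ Bi ⊆ S ∩ cl c i, i ∈ I → Bi.card = t1 i := by
    intro i
    by_cases hi : i ∈ I
    · obtain ⟨Bi, h1, h2⟩ := exists_subset_card_eq (s := S ∩ cl c i) (n := t1 i)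
        (by rw [hS i hi]; omega)
      exact ⟨Bi, h1, fun _ => h2⟩
    · exact ⟨∅, by simp, fun h => absurd h hi⟩
  choose b hb1 hb2 using this
  have hB : ∀ i ∈ I, S.filter (fun x => x ∈ b (c x)) ∩ cl c i = b i := by
    intro i hi
    ext x
    simp only [mem_inter, mem_filter, mem_cl]
    constructor
    · rintro ⟨⟨_, h1⟩, rfl⟩; exact h1
    · intro h
      have := hb1 i h
      rw [mem_inter, mem_cl] at this
      obtain ⟨h1, rfl⟩ := this
      exact ⟨⟨h1, h⟩, rfl⟩
  refine ⟨S.filter (fun x => x ∈ b (c x)), S \ S.filter (fun x => x ∈ b (c x)),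
    filter_subset _ _, sdiff_subset, disjoint_sdiff, ?_, ?_⟩
  · intro i hi
    rw [hB i hi, hb2 i hi]
  · intro i hi
    have h1 : (S \ S.filter (fun x => x ∈ b (c x))) ∩ cl c i = (S ∩ cl c i) \ b i := by
      rw [← hB i hi]
      ext x
      simp only [mem_inter, mem_sdiff]
      tauto
    rw [h1, card_sdiff_of_subset (hb1 i), hb2 i hi, hS i hi]
    omega
end
end BlowUp

set_option linter.unusedSectionVars false

namespace BlowUp
open Finset
section
open scoped Classical
variable {V ι : Type*} [Fintype V]
variable {c : V → ι} {G H : SimpleGraph V} {D : ℕ} {d ε : ℝ}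

/-- all parameter inequalities -/
structure Par (D f : ℕ) (d ε κ β γ η τ τ' : ℝ) (m N : ℕ) : Prop where
  p2 : Par2 D d ε β γ η τ τ' m
  hD : 1 ≤ D
  hκ : 0 < κ
  hκ1 : κ ≤ 1
  hκf : f * D * κ ≤ 1 / 8
  hβsel : ((D : ℝ) + 1) ^ 3 * f * (4 * β) ≤ 1 / 2
  hβ1 : β ≤ 1 / 2
  hused : D * f * (2 * β) / κ + 2 * η ≤ d ^ D / 4
  hTγ : D * f * (2 * η) / κ ≤ γ / 2
  hm : (f : ℝ) + 1 + D ≤ m * (γ / 2)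
  hN1 : 1 ≤ N
  hNη : 1 ≤ η * N
  hNτ : 2 ≤ τ * N
  hεN : ε * N ≤ κ
  hεη : D * ε ≤ η / 2

/-- properties of the selected sets -/
structure Sel (c : V → ι) (H : SimpleGraph V) (κ β η : ℝ) (I : Finset ι) (B R : Finset V) :
    Prop where
  Bsz : ∀ i ∈ I, β * (cl c i).card ≤ ((B ∩ cl c i).card : ℝ)
  Bsz2 : ∀ i ∈ I, ((B ∩ cl c i).card : ℝ) ≤ 2 * β * (cl c i).card
  Rsz : ∀ i ∈ I, η * (cl c i).card ≤ ((R ∩ cl c i).card : ℝ)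
  Rsz2 : ∀ i ∈ I, ((R ∩ cl c i).card : ℝ) ≤ 2 * η * (cl c i).card
  BI : ∀ x ∈ B, c x ∈ I
  RI : ∀ x ∈ R, c x ∈ I
  Brule : ∀ x ∈ B, Rule c H κ x
  Rrule : ∀ x ∈ R, Rule c H κ x
  disj : Disjoint B R
  far : ∀ x ∈ B ∪ R, ∀ y ∈ B ∪ R, x ≠ y → ¬ near H x y

variable {κ β γ η τ τ' : ℝ} {m f N : ℕ} {T B R : Finset V} {I : Finset ι} {E : Finset V}
  {φ : V → V}

lemma exists_sel [Fintype ι] (hdeg : ∀ x, (nbr H x).card ≤ D)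
    (hp : Par D (Fintype.card ι) d ε κ β γ η τ τ' m N)
    (hI : ∀ i ∈ I, N ≤ (cl c i).card) : ∃ B R, Sel c H κ β η I B R := by
  have hβ := hp.p2.hβ
  have hη := hp.p2.hη
  have hηβ := hp.p2.hηβ
  have hηn : ∀ i ∈ I, 1 ≤ η * (cl c i).card := fun i hi => by
    have h1 : (N : ℝ) ≤ (cl c i).card := by exact_mod_cast hI i hi
    nlinarith [hp.hNη]
  have hβn : ∀ i ∈ I, 1 ≤ β * (cl c i).card := fun i hi => by
    have h1 := hηn i hi
    have h2 : (0 : ℝ) ≤ (cl c i).card := by positivity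
    nlinarith
  have hc1 : ∀ i ∈ I, (⌈β * (cl c i).card⌉₊ : ℝ) ≤ 2 * β * (cl c i).card := fun i hi => by
    have := (Nat.ceil_lt_add_one (by positivity : 0 ≤ β * ((cl c i).card : ℝ))).le
    linarith [hβn i hi]
  have hc2 : ∀ i ∈ I, (⌈η * (cl c i).card⌉₊ : ℝ) ≤ 2 * η * (cl c i).card := fun i hi => by
    have := (Nat.ceil_lt_add_one (by positivity : 0 ≤ η * ((cl c i).card : ℝ))).le
    linarith [hηn i hi]
  obtain ⟨S, hS1, hS2, hS3⟩ := select (c := c) hdeg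
    (fun i => ⌈β * (cl c i).card⌉₊ + ⌈η * (cl c i).card⌉₊) (Rule c H κ) I (by
      intro i hi
      have h1 := rule_card (c := c) hdeg i hp.hκ.le
      have hn : (0 : ℝ) ≤ (cl c i).card := by positivity
      have h2 : ((∑ j ∈ I.filter (fun j => (cl c j).card ≤ (cl c i).card),
          (⌈β * (cl c j).card⌉₊ + ⌈η * (cl c j).card⌉₊) : ℕ) : ℝ) ≤
          Fintype.card ι * (4 * β * (cl c i).card) := by
        push_cast
        calc _ ≤ ∑ j ∈ I.filter (fun j => (cl c j).card ≤ (cl c i).card),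
              (4 * β * (cl c i).card : ℝ) := by
              refine sum_le_sum fun j hj => ?_
              rw [mem_filter] at hj
              have h3 : ((cl c j).card : ℝ) ≤ (cl c i).card := by exact_mod_cast hj.2
              have h4 := hc1 j hj.1
              have h5 := hc2 j hj.1
              have h6 : (0 : ℝ) ≤ (cl c j).card := by positivity
              nlinarith
          _ = _ := by rw [sum_const, nsmul_eq_mul]
          _ ≤ _ := by gcongr; exact card_le_univ _
      have h3 : (((cl c i).filter (fun x => ¬ Rule c H κ x)).card : ℝ) + ((D : ℝ) + 1) ^ 3 *
          ((∑ j ∈ I.filter (fun j => (cl c j).card ≤ (cl c i).card),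
          (⌈β * (cl c j).card⌉₊ + ⌈η * (cl c j).card⌉₊) : ℕ) : ℝ) ≤ (cl c i).card := by
        have h4 := mul_le_mul_of_nonneg_left h2 (by positivity : (0 : ℝ) ≤ ((D : ℝ) + 1) ^ 3)
        have h5 := mul_le_mul_of_nonneg_right hp.hβsel hn
        have h6 := mul_le_mul_of_nonneg_right hp.hκf hn
        nlinarith
      exact_mod_cast h3)
  obtain ⟨B, R, hB, hR, hdis, hBc, hRc⟩ := split (c := c) hS3
  refine ⟨B, R, ?_, ?_, ?_, ?_, fun x hx => (hS1 x (hB hx)).2, fun x hx => (hS1 x (hR hx)).2,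
    fun x hx => (hS1 x (hB hx)).1, fun x hx => (hS1 x (hR hx)).1, hdis, ?_⟩
  · intro i hi; rw [hBc i hi]; exact Nat.le_ceil _
  · intro i hi; rw [hBc i hi]; exact hc1 i hi
  · intro i hi; rw [hRc i hi]; exact Nat.le_ceil _
  · intro i hi; rw [hRc i hi]; exact hc2 i hi
  · intro x hx y hy
    exact hS2 x (union_subset hB hR hx) y (union_subset hB hR hy)

lemma badBound_of [Fintype ι] (hS : Setup c G H D d ε)
    (hp : Par D f d ε κ β γ η τ τ' m N)
    (hI : ∀ i ∈ I, N ≤ (cl c i).card)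
    (hT : ∀ i ∈ I, ((cl c i \ T).card : ℝ) ≤ γ / 2 * (cl c i).card) :
    BadBound c G H d γ η m T I f := by
  intro E φ hP i hi W hW hWc
  have h1 := bad_bound hS hP hi hW hWc
  have hn : (1 : ℝ) ≤ (cl c i).card := by exact_mod_cast hp.hN1.trans (hI i hi)
  have h2 : (m : ℝ) * bad c G H d T E φ i W ≤ f + (cl c i).card + D * (cl c i).card := by
    exact_mod_cast h1
  have hγ := hp.p2.hγ
  have hm0 : (0 : ℝ) < m := by
    by_contra hcon
    push Not at hcon
    have := hp.hm
    have h4 : (m : ℝ) * (γ / 2) ≤ 0 := mul_nonpos_of_nonpos_of_nonneg hcon (by positivity)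
    have h5 : (0 : ℝ) ≤ f := by positivity
    have h6 : (0 : ℝ) ≤ D := by positivity
    linarith
  have h3 : (bad c G H d T E φ i W : ℝ) ≤ γ / 2 * (cl c i).card := by
    have h4 := mul_le_mul_of_nonneg_right hp.hm (by linarith : (0 : ℝ) ≤ (cl c i).card)
    have h5 : (f : ℝ) ≤ f * (cl c i).card := by
      have : (0 : ℝ) ≤ f := by positivity
      nlinarith
    have h6 : (m : ℝ) * bad c G H d T E φ i W ≤ m * (γ / 2 * (cl c i).card) := by nlinarith
    exact le_of_mul_le_mul_left h6 hm0
  have hsub : (cl c i).filter (fun z => ¬ Good c G H d E φ z W) ⊆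
      (T ∩ cl c i).filter (fun z => ¬ Good c G H d E φ z W) ∪ (cl c i \ T) := by
    intro z hz
    rw [mem_filter] at hz
    by_cases hzT : z ∈ T
    · exact mem_union_left _ (mem_filter.2 ⟨mem_inter.2 ⟨hzT, hz.1⟩, hz.2⟩)
    · exact mem_union_right _ (mem_sdiff.2 ⟨hz.1, hzT⟩)
  have h7 : (((cl c i).filter (fun z => ¬ Good c G H d E φ z W)).card : ℝ) ≤
      bad c G H d T E φ i W + (cl c i \ T).card := by
    exact_mod_cast (card_le_card hsub).trans (card_union_le _ _)
  linarith [hT i hi]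

lemma small_nonadj (hS : Setup c G H D d ε) (hp : Par D f d ε κ β γ η τ τ' m N)
    {x y v : V} (hxy : H.Adj x y) (hx : (cl c (c x)).card < N) (hv : c v = c x) :
    (((cl c (c y)).filter (fun w => ¬ G.Adj v w)).card : ℝ) < ε * (cl c (c y)).card := by
  by_contra hcon
  push Not at hcon
  have h1 := hS.reg x y hxy _ (filter_subset _ _) hcon
  have h2 : v ∈ (cl c (c x)).filter (fun u => ((nbr G u ∩
      (cl c (c y)).filter (fun w => ¬ G.Adj v w)).card : ℝ) ≤
      d * ((cl c (c y)).filter (fun w => ¬ G.Adj v w)).card) := by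
    rw [mem_filter]
    refine ⟨by simpa using hv, ?_⟩
    have : nbr G v ∩ (cl c (c y)).filter (fun w => ¬ G.Adj v w) = ∅ := by
      ext w; simp; tauto
    rw [this, card_empty]
    have := hS.hd
    push_cast
    positivity
  have h3 : (1 : ℝ) ≤ _ := Nat.one_le_cast.2 (card_pos.2 ⟨v, h2⟩)
  have h4 : ((cl c (c x)).card : ℝ) < N := by exact_mod_cast hx
  have := hS.hε
  nlinarith [hp.hεN, hp.hκ1]

lemma small_complete (hS : Setup c G H D d ε) (hp : Par D f d ε κ β γ η τ τ' m N)
    {x y v w : V} (hxy : H.Adj x y) (hx : (cl c (c x)).card < N) (hv : c v = c x)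
    (hy : κ * (cl c (c y)).card < N) (hw : c w = c y) : G.Adj v w := by
  by_contra hcon
  have h1 := small_nonadj hS hp hxy hx hv
  have h2 : (1 : ℝ) ≤ (((cl c (c y)).filter (fun w => ¬ G.Adj v w)).card : ℝ) :=
    Nat.one_le_cast.2 (card_pos.2 ⟨w, by simp [hw, hcon]⟩)
  have h3 : 1 < ε * (cl c (c y)).card := by linarith
  have hκ := hp.hκ
  have hε := hS.hε
  have h4 := hp.hεN
  have h5 : κ * 1 < κ * (ε * (cl c (c y)).card) := by gcongr
  have h6 : ε * (κ * (cl c (c y)).card) < ε * N := by gcongr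
  linarith

/-- The embedded vertices at the start. -/
noncomputable def E0 (c : V → ι) (I : Finset ι) : Finset V := univ.filter (fun x => c x ∉ I)

lemma mem_E0 {x : V} : x ∈ E0 c I ↔ c x ∉ I := by simp [E0]

lemma valid0 (hS : Setup c G H D d ε) (hp : Par D f d ε κ β γ η τ τ' m N)
    (hI : ∀ i, i ∉ I → (cl c i).card < N) : Valid c G H (E0 c I) id := by
  refine ⟨fun _ _ => rfl, Set.injOn_id _, fun x hx y hy hxy => ?_⟩
  have h1 := hI _ (mem_E0.1 hx)
  have h2 := hI _ (mem_E0.1 hy)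
  refine small_complete hS hp hxy h1 rfl ?_ rfl
  have h3 : ((cl c (c y)).card : ℝ) < N := by exact_mod_cast h2
  nlinarith [hp.hκ1, hp.hκ, (Nat.cast_nonneg (cl c (c y)).card : (0 : ℝ) ≤ _)]

lemma miss0 (hS : Setup c G H D d ε) (hp : Par D f d ε κ β γ η τ τ' m N)
    (hI : ∀ i, i ∉ I → (cl c i).card < N) (z : V) :
    ((cl c (c z) \ Cand c G H (E0 c I) id z).card : ℝ) ≤
      kk H (E0 c I) z * (ε * (cl c (c z)).card) := by
  have hsub : cl c (c z) \ Cand c G H (E0 c I) id z ⊆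
      ((E0 c I).filter (fun y => H.Adj y z)).biUnion
        (fun y => (cl c (c z)).filter (fun w => ¬ G.Adj y w)) := by
    intro v hv
    rw [mem_sdiff, mem_Cand, mem_cl] at hv
    obtain ⟨h1, h2⟩ := hv
    push Not at h2
    obtain ⟨y, hy, hyz, hn⟩ := h2 h1
    exact mem_biUnion.2 ⟨y, mem_filter.2 ⟨hy, hyz⟩, mem_filter.2 ⟨by simpa using h1, hn⟩⟩
  have h1 : ((cl c (c z) \ Cand c G H (E0 c I) id z).card : ℝ) ≤
      ∑ y ∈ (E0 c I).filter (fun y => H.Adj y z),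
        (((cl c (c z)).filter (fun w => ¬ G.Adj y w)).card : ℝ) := by
    exact_mod_cast (card_le_card hsub).trans card_biUnion_le
  refine h1.trans ?_
  have h2 : ∀ y ∈ (E0 c I).filter (fun y => H.Adj y z),
      (((cl c (c z)).filter (fun w => ¬ G.Adj y w)).card : ℝ) ≤ ε * (cl c (c z)).card := by
    intro y hy
    rw [mem_filter, mem_E0] at hy
    exact (small_nonadj hS hp hy.2 (hI _ hy.1) rfl).le
  refine (sum_le_sum h2).trans ?_
  rw [sum_const, nsmul_eq_mul]
  rfl

lemma good0 (hS : Setup c G H D d ε) (hp : Par D f d ε κ β γ η τ τ' m N)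
    (hI : ∀ i, i ∉ I → (cl c i).card < N) (z : V) (W : Finset V) (hW : W ⊆ cl c (c z))
    (hWc : η * (cl c (c z)).card ≤ W.card) : Good c G H d (E0 c I) id z W := by
  unfold Good
  have h1 := miss0 hS hp hI z
  have hsub : W ⊆ (Cand c G H (E0 c I) id z ∩ W) ∪ (cl c (c z) \ Cand c G H (E0 c I) id z) := by
    intro w hw
    by_cases hwC : w ∈ Cand c G H (E0 c I) id z
    · exact mem_union_left _ (mem_inter.2 ⟨hwC, hw⟩)
    · exact mem_union_right _ (mem_sdiff.2 ⟨hW hw, hwC⟩)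
  have h2 : (W.card : ℝ) ≤ (Cand c G H (E0 c I) id z ∩ W).card +
      (cl c (c z) \ Cand c G H (E0 c I) id z).card := by
    exact_mod_cast (card_le_card hsub).trans (card_union_le _ _)
  rcases Nat.eq_zero_or_pos (kk H (E0 c I) z) with h0 | h0
  · rw [h0] at h1 ⊢
    simp only [Nat.cast_zero, zero_mul] at h1
    rw [pow_zero, one_mul]
    linarith
  · have hd := hS.hd
    have h3 : d ^ kk H (E0 c I) z ≤ 1 / 2 := by
      calc d ^ kk H (E0 c I) z ≤ d ^ 1 :=
            pow_le_pow_of_le_one hd.le (by linarith [hS.hd2]) h0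
        _ ≤ _ := by rw [pow_one]; exact hS.hd2
    have h4 : (kk H (E0 c I) z : ℝ) ≤ D := by exact_mod_cast kk_le hS _ z
    have hn : (0 : ℝ) ≤ (cl c (c z)).card := by positivity
    have h5 : (kk H (E0 c I) z : ℝ) * (ε * (cl c (c z)).card) ≤ η / 2 * (cl c (c z)).card := by
      calc _ ≤ (D : ℝ) * (ε * (cl c (c z)).card) := by
            have := hS.hε
            gcongr
        _ = D * ε * (cl c (c z)).card := by ring
        _ ≤ _ := by
          have := hp.hεη
          gcongr
    have h6 : d ^ kk H (E0 c I) z * W.card ≤ 1 / 2 * W.card := by gcongr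
    linarith

lemma Av_lower (hV : Valid c G H E φ) (z : V) :
    ((Cand c G H E φ z).card : ℝ) ≤ (Av c G H E φ z).card + (cl c (c z) ∩ E).card := by
  have h1 := card_free hV (c z)
  have h3 := card_sdiff_add_card_inter (cl c (c z)) (E.image φ)
  have h4 := card_sdiff_add_card_inter (cl c (c z)) E
  have h5 : Cand c G H E φ z ⊆ Av c G H E φ z ∪ (cl c (c z) ∩ E.image φ) := by
    intro v hv
    by_cases hvi : v ∈ E.image φ
    · exact mem_union_right _ (mem_inter.2 ⟨Cand_subset hv, hvi⟩)
    · exact mem_union_left _ (mem_sdiff.2 ⟨hv, hvi⟩)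
  have h6 := (card_le_card h5).trans (card_union_le _ _)
  have h7 : (Cand c G H E φ z).card ≤ (Av c G H E φ z).card + (cl c (c z) ∩ E).card := by omega
  exact_mod_cast h7

lemma Pot_congr {E' : Finset V} {φ' : V → V}
    (h : ∀ z ∈ T, Cand c G H E' φ' z = Cand c G H E φ z ∧ kk H E' z = kk H E z) :
    Pot c G H d η m T I E' φ' = Pot c G H d η m T I E φ := by
  unfold Pot
  refine sum_congr rfl fun i _ => sum_congr rfl fun W _ => ?_
  have h1 : bad c G H d T E' φ' i W = bad c G H d T E φ i W := by
    unfold bad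
    congr 1
    refine filter_congr fun z hz => ?_
    unfold Good
    rw [(h z (mem_inter.1 hz).1).1, (h z (mem_inter.1 hz).1).2]
  have h2 : ss c H T E' i = ss c H T E i := by
    unfold ss
    exact sum_congr rfl fun z hz => (h z (mem_inter.1 hz).1).2
  rw [h1, h2]
end
end BlowUp

set_option linter.unusedSectionVars false

namespace BlowUp
open Finset
section
open scoped Classical
variable {V ι : Type*} [Fintype V]
variable {c : V → ι} {G H : SimpleGraph V} {D : ℕ} {d ε : ℝ}
variable {κ β γ η τ τ' : ℝ} {m f N : ℕ} {T B R : Finset V} {I : Finset ι} {E : Finset V}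
  {φ : V → V}

lemma used_NB [Fintype ι] (hS : Setup c G H D d ε)
    (hp : Par D (Fintype.card ι) d ε κ β γ η τ τ' m N)
    (hsel : Sel c H κ β η I B R) {P : Finset V} {j : ι}
    (hP : ∀ y ∈ P, c y = j → ∃ b ∈ B, H.Adj b y) :
    ((cl c j ∩ P).card : ℝ) ≤ D * Fintype.card ι * (2 * β) / κ * (cl c j).card := by
  have hβ := hp.p2.hβ
  have h1 := nb_card (c := c) hS.deg hp.hκ (by positivity : 0 ≤ 2 * β) hsel.Brule
    (fun x hx => hsel.Bsz2 _ (hsel.BI x hx)) j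
  refine le_trans ?_ h1
  norm_cast
  refine card_le_card fun y hy => ?_
  rw [mem_inter, mem_cl] at hy
  rw [mem_filter, mem_cl]
  exact ⟨hy.1, hP y hy.2 hy.1⟩

lemma Par.tau_le (hS : Setup c G H D d ε) (hp : Par D f d ε κ β γ η τ τ' m N) :
    τ ≤ d ^ D / 4 := by
  rw [hp.p2.hτ]
  have := pow_pos hS.hd D
  nlinarith [hp.hβ1]

lemma Par.tau_pos (hS : Setup c G H D d ε) (hp : Par D f d ε κ β γ η τ τ' m N) :
    0 < τ := by
  rw [hp.p2.hτ]
  have := pow_pos hS.hd D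
  have := hp.p2.hβ
  positivity

lemma Par.tau'_le (hS : Setup c G H D d ε) (hp : Par D f d ε κ β γ η τ τ' m N) :
    2 * τ' ≤ τ := by
  have h1 := hp.p2.hγτ
  have h2 : d ^ (D + 1) ≤ 1 := pow_le_one₀ hS.hd.le (by linarith [hS.hd2])
  have h3 := hp.tau_pos hS
  have h4 := hp.p2.hγ
  nlinarith

lemma Good.card (hS : Setup c G H D d ε) {z : V} (h : Good c G H d E φ z (cl c (c z))) :
    d ^ D * (cl c (c z)).card ≤ ((Cand c G H E φ z).card : ℝ) := by
  unfold Good at h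
  rw [inter_eq_left.2 Cand_subset] at h
  refine le_trans ?_ h
  have := hS.hd
  gcongr ?_ * _
  exact pow_le_pow_of_le_one hS.hd.le (by linarith [hS.hd2]) (kk_le hS _ _)

lemma phase1 [Fintype ι] (hS : Setup c G H D d ε)
    (hp : Par D (Fintype.card ι) d ε κ β γ η τ τ' m N)
    (hI2 : ∀ i, i ∉ I → (cl c i).card < N)
    (hsel : Sel c H κ β η I B R) (T : Finset V) (P : Finset V)
    (hP : ∀ y ∈ P, c y ∈ I ∧ ∃ b ∈ B, H.Adj b y) :
    ∃ φ, Valid c G H (E0 c I ∪ P) φ ∧ (∀ x ∈ E0 c I, φ x = x) ∧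
      Pot c G H d η m T I (E0 c I ∪ P) φ ≤ Fintype.card ι ∧
      ∀ z, z ∉ E0 c I ∪ P → Good c G H d (E0 c I ∪ P) φ z (cl c (c z)) := by
  induction P using Finset.induction_on with
  | empty =>
    rw [union_empty]
    have hη1 : η ≤ 1 := by linarith [hp.p2.hηβ, hp.hβ1]
    refine ⟨id, valid0 hS hp hI2, fun _ _ => rfl, ?_, ?_⟩
    · refine (Pot_start fun z _ W hW hWc => good0 hS hp hI2 z W hW hWc).trans ?_
      exact_mod_cast card_le_univ I
    · intro z _
      refine good0 hS hp hI2 z _ Subset.rfl ?_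
      have : (0 : ℝ) ≤ (cl c (c z)).card := by positivity
      nlinarith
  | insert y P hyP ih =>
    obtain ⟨φ, hV, hid, hpot, hgood⟩ := ih fun x hx => hP x (mem_insert_of_mem hx)
    obtain ⟨hyI, -⟩ := hP y (mem_insert_self _ _)
    have hy0 : y ∉ E0 c I := by rw [mem_E0]; simpa using hyI
    have hy : y ∉ E0 c I ∪ P := by simp [hy0, hyP]
    have hn : (0 : ℝ) ≤ (cl c (c y)).card := by positivity
    have hA : 2 * τ' * (cl c (c y)).card ≤ (Av c G H (E0 c I ∪ P) φ y).card := by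
      have h1 := (hgood y hy).card hS
      have h2 := Av_lower hV y
      have h3 := used_NB hS hp hsel (P := E0 c I ∪ P) (j := c y) (by
        intro x hx hxy
        rcases mem_union.1 hx with hx | hx
        · rw [mem_E0, hxy] at hx; exact absurd hyI hx
        · exact (hP x (mem_insert_of_mem hx)).2)
      have h4 := mul_le_mul_of_nonneg_right hp.hused hn
      have h5 := mul_le_mul_of_nonneg_right (hp.tau'_le hS) hn
      have h6 := mul_le_mul_of_nonneg_right (hp.tau_le hS) hn
      have h7 := mul_nonneg hp.p2.hη.le hn
      have h8 := mul_nonneg (pow_pos hS.hd D).le hn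
      nlinarith
    obtain ⟨u, hu, hu1, hu2⟩ := step hS (T := T) hy I hp.p2.hεη hp.p2.hτ' hp.p2.hM hA
      (fun z => Cand c G H (E0 c I ∪ P) φ z) (by
        intro z hz hyz
        refine ⟨Cand_subset, le_trans ?_ ((hgood z hz).card hS)⟩
        gcongr
        have h1 := hp.p2.hεη
        have h2 := pow_pos hS.hd D
        have : η ≤ 1 := by linarith [hp.p2.hηβ, hp.hβ1]
        nlinarith)
    rw [union_insert]
    refine ⟨Function.update φ y u, hV.step hy hu, ?_, hu2.trans hpot, ?_⟩
    · intro x hx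
      rw [Function.update_of_ne (by rintro rfl; exact hy0 hx)]
      exact hid x hx
    · intro z hz
      rw [mem_insert, not_or] at hz
      have hg := hgood z hz.2
      unfold Good at hg ⊢
      by_cases hyz : H.Adj y z
      · rw [Cand_step_adj hy hyz, kk_step_adj hy hyz]
        have h1 := hu1 z hz.2 hyz
        rw [inter_eq_left.2 Cand_subset] at hg
        rw [inter_eq_left.2 (inter_subset_right.trans Cand_subset), pow_succ']
        have h2 := mul_le_mul_of_nonneg_left hg hS.hd.le
        linarith
      · rw [Cand_step_nadj hy hyz, kk_step_nadj hyz]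
        exact hg

lemma W_small (hS : Setup c G H D d ε) (hp : Par D f d ε κ β γ η τ τ' m N)
    (hbb : BadBound c G H d γ η m T I f) (hsel : Sel c H κ β η I B R)
    (hN : ∀ i ∈ I, N ≤ (cl c i).card)
    (hpot : Pot c G H d η m T I E φ ≤ f) {i : ι} (hi : i ∈ I) {W : Finset V}
    (hW : W ⊆ cl c i)
    (hWv : ∀ v ∈ W, (((B ∩ cl c i).filter (fun b => v ∈ Cand c G H E φ b)).card : ℝ) <
      τ * (cl c i).card) :
    (W.card : ℝ) < η * (cl c i).card := by
  by_contra hcon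
  push Not at hcon
  have h1 := hbb E φ hpot i hi W hW hcon
  have hn : (1 : ℝ) ≤ (cl c i).card := by exact_mod_cast hp.hN1.trans (hN i hi)
  have hWpos : (0 : ℝ) < W.card := by
    have := hp.p2.hη
    have : 0 < η * (cl c i).card := by positivity
    linarith
  set BG := (B ∩ cl c i).filter (fun z => Good c G H d E φ z W) with hBG
  have h2 : ((B ∩ cl c i).card : ℝ) ≤ BG.card + γ * (cl c i).card := by
    have h3 : (B ∩ cl c i) ⊆ BG ∪ (cl c i).filter (fun z => ¬ Good c G H d E φ z W) := by
      intro z hz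
      by_cases hg : Good c G H d E φ z W
      · exact mem_union_left _ (mem_filter.2 ⟨hz, hg⟩)
      · exact mem_union_right _ (mem_filter.2 ⟨(mem_inter.1 hz).2, hg⟩)
    have h4 : ((B ∩ cl c i).card : ℝ) ≤
        BG.card + ((cl c i).filter (fun z => ¬ Good c G H d E φ z W)).card := by
      exact_mod_cast (card_le_card h3).trans (card_union_le _ _)
    linarith
  have h3 : ∑ b ∈ B ∩ cl c i, ((Cand c G H E φ b ∩ W).card : ℝ) =
      ∑ v ∈ W, (((B ∩ cl c i).filter (fun b => v ∈ Cand c G H E φ b)).card : ℝ) := by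
    have : ∀ b, (Cand c G H E φ b ∩ W) = W.filter (fun v => v ∈ Cand c G H E φ b) := by
      intro b; ext v; simp; tauto
    simp only [this]
    exact_mod_cast sum_card_bipartiteAbove_eq_sum_card_bipartiteBelow
      (s := B ∩ cl c i) (t := W) (fun b v => v ∈ Cand c G H E φ b)
  have h4 : ∑ v ∈ W, (((B ∩ cl c i).filter (fun b => v ∈ Cand c G H E φ b)).card : ℝ) <
      W.card * (τ * (cl c i).card) := by
    rw [← nsmul_eq_mul, ← sum_const]
    refine sum_lt_sum_of_nonempty ?_ hWv
    exact card_pos.1 (by exact_mod_cast hWpos)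
  have h5 : (BG.card : ℝ) * (d ^ D * W.card) ≤
      ∑ b ∈ B ∩ cl c i, ((Cand c G H E φ b ∩ W).card : ℝ) := by
    rw [← nsmul_eq_mul, ← sum_const]
    refine (sum_le_sum fun b hb => ?_).trans
      (sum_le_sum_of_subset_of_nonneg (filter_subset _ _) fun _ _ _ => by positivity)
    have hg := (mem_filter.1 hb).2
    unfold Good at hg
    refine le_trans ?_ hg
    have := hS.hd
    gcongr ?_ * _
    exact pow_le_pow_of_le_one hS.hd.le (by linarith [hS.hd2]) (kk_le hS _ _)
  have h6 := hsel.Bsz i hi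
  have h7 : β / 2 * (cl c i).card ≤ (BG.card : ℝ) := by
    have := hp.p2.hγβ
    nlinarith
  have h8 : β / 2 * (cl c i).card * (d ^ D * W.card) ≤ BG.card * (d ^ D * W.card) := by
    have := hS.hd
    gcongr
  have h9 : β / 2 * (cl c i).card * (d ^ D * W.card) = W.card * (τ * (cl c i).card) := by
    rw [hp.p2.hτ]; ring
  linarith

lemma Cand_congr {E' : Finset V} {φ' : V → V} {z : V} (h1 : E ⊆ E')
    (h2 : ∀ x ∈ E, φ' x = φ x) (h3 : ∀ y ∈ E', y ∉ E → ¬ H.Adj y z) :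
    Cand c G H E' φ' z = Cand c G H E φ z ∧ kk H E' z = kk H E z := by
  constructor
  · ext v
    rw [mem_Cand, mem_Cand]
    refine and_congr_right fun _ => ⟨fun h y hy hyz => ?_, fun h y hy hyz => ?_⟩
    · rw [← h2 y hy]; exact h y (h1 hy) hyz
    · have : y ∈ E := by
        by_contra hcon
        exact h3 y hy hcon hyz
      rw [h2 y this]; exact h y this hyz
  · unfold kk
    congr 1
    ext y
    simp only [mem_filter]
    refine ⟨fun h => ⟨?_, h.2⟩, fun h => ⟨h1 h.1, h.2⟩⟩
    by_contra hcon
    exact h3 y h.1 hcon h.2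

lemma Sel.far1 (hsel : Sel c H κ β η I B R) {b r y : V} (hb : b ∈ B) (hr : r ∈ R)
    (h1 : H.Adj b y) (h2 : y = r ∨ H.Adj y r ∨ ∃ z, H.Adj y z ∧ H.Adj z r) : False := by
  have hne : b ≠ r := by
    rintro rfl
    exact disjoint_left.1 hsel.disj hb hr
  refine hsel.far b (mem_union_left _ hb) r (mem_union_right _ hr) hne ?_
  rcases h2 with rfl | h2 | ⟨z, h2, h3⟩
  · exact ⟨y, y, Or.inr h1, Or.inl rfl, Or.inl rfl⟩
  · exact ⟨y, r, Or.inr h1, Or.inr h2, Or.inl rfl⟩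
  · exact ⟨y, z, Or.inr h1, Or.inr h2, Or.inr h3⟩

lemma Sel.far2 (hsel : Sel c H κ β η I B R) {b b' : V} (hb : b ∈ B) (hb' : b' ∈ B)
    (h1 : H.Adj b b') : False := by
  refine hsel.far b (mem_union_left _ hb) b' (mem_union_left _ hb') h1.ne ?_
  exact ⟨b', b', Or.inr h1, Or.inl rfl, Or.inl rfl⟩

lemma Sel.far3 (hsel : Sel c H κ β η I B R) {b b' z : V} (hb : b ∈ R) (hb' : b' ∈ R)
    (hne : b ≠ b')
    (h1 : H.Adj b b' ∨ (H.Adj b z ∧ H.Adj z b')) : False := by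
  refine hsel.far b (mem_union_right _ hb) b' (mem_union_right _ hb') hne ?_
  rcases h1 with h1 | h1
  · exact ⟨b', b', Or.inr h1, Or.inl rfl, Or.inl rfl⟩
  · exact ⟨z, b', Or.inr h1.1, Or.inr h1.2, Or.inl rfl⟩

lemma fix (hS : Setup c G H D d ε) (hp : Par D f d ε κ β γ η τ τ' m N)
    (hI2 : ∀ i, i ∉ I → (cl c i).card < N)
    (hsel : Sel c H κ β η I B R) {E1 : Finset V} {φ1 : V → V} (hV : Valid c G H E1 φ1)
    (hE1 : ∀ x ∈ E1, c x ∉ I ∨ ∃ b ∈ B, H.Adj b x) (W : Finset V)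
    (hW : ∀ v ∈ W, v ∉ E1.image φ1 ∧ c v ∈ I)
    (hWc : ∀ i ∈ I, ((W ∩ cl c i).card : ℝ) < η * (cl c i).card) :
    ∀ P ⊆ W, ∃ E φ, Valid c G H E φ ∧ E1 ⊆ E ∧ E ⊆ E1 ∪ R ∧ (∀ x ∈ E1, φ x = φ1 x) ∧
      P ⊆ E.image φ ∧ (∀ x ∈ E, x ∉ E1 → φ x ∈ P) := by
  have hRE : ∀ r ∈ R, r ∉ E1 := by
    intro r hr hrE
    rcases hE1 r hrE with h | ⟨b, hb, hbr⟩
    · exact h (hsel.RI r hr)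
    · exact hsel.far1 hb hr hbr (Or.inl rfl)
  intro P
  induction P using Finset.induction_on with
  | empty =>
    intro _
    exact ⟨E1, φ1, hV, Subset.rfl, subset_union_left, fun _ _ => rfl, empty_subset _,
      fun x hx hx' => absurd hx hx'⟩
  | insert v P hvP ih =>
    intro hPW
    have hPW' : P ⊆ W := (subset_insert _ _).trans hPW
    obtain ⟨E, φ, hVE, hE1E, hER, hag, hPE, hEP⟩ := ih hPW'
    have hvW := hPW (mem_insert_self _ _)
    obtain ⟨hv1, hvI⟩ := hW v hvW
    obtain ⟨r, hrR, hrE⟩ : ∃ r ∈ R ∩ cl c (c v), r ∉ E := by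
      by_contra hcon
      push Not at hcon
      have h1 : (R ∩ cl c (c v)).card ≤ (W ∩ cl c (c v)).card := by
        refine card_le_card_of_injOn φ ?_ ?_
        · intro r hr
          have hr : r ∈ R ∩ cl c (c v) := hr
          have h2 := hcon r hr
          rw [mem_inter, mem_cl] at hr
          have h3 := hEP r h2 (hRE r hr.1)
          have h4 := hVE.cls r h2
          have : φ r ∈ W ∩ cl c (c v) := by
            rw [mem_inter, mem_cl, h4]
            exact ⟨hPW' h3, hr.2⟩
          exact this
        · exact hVE.inj.mono fun r hr => hcon r hr
      have h2 : ((R ∩ cl c (c v)).card : ℝ) ≤ (W ∩ cl c (c v)).card := by exact_mod_cast h1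
      linarith [hsel.Rsz _ hvI, hWc _ hvI]
    rw [mem_inter, mem_cl] at hrR
    have hvim : v ∉ E.image φ := by
      intro hcon
      obtain ⟨x, hx, hxv⟩ := mem_image.1 hcon
      by_cases hx1 : x ∈ E1
      · rw [hag x hx1] at hxv
        exact hv1 (mem_image.2 ⟨x, hx1, hxv⟩)
      · have := hEP x hx hx1
        rw [hxv] at this
        exact hvP this
    have hvA : v ∈ Av c G H E φ r := by
      rw [mem_Av, mem_Cand]
      refine ⟨⟨hrR.2.symm, fun y hy hyr => ?_⟩, hvim⟩
      rcases mem_union.1 (hER hy) with hy1 | hyR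
      · rcases hE1 y hy1 with h | ⟨b, hb, hby⟩
        · have h1 := hsel.Rrule r hrR.1 y hyr.symm
          refine small_complete hS hp hyr (hI2 _ h) (hVE.cls y hy) ?_ hrR.2.symm
          have h2 : ((cl c (c y)).card : ℝ) < N := by exact_mod_cast hI2 _ h
          linarith
        · exact (hsel.far1 hb hrR.1 hby (Or.inr (Or.inl hyr))).elim
      · exact (hsel.far3 (z := y) hyR hrR.1 hyr.ne (Or.inl hyr)).elim
    refine ⟨insert r E, Function.update φ r v, hVE.step hrE hvA, hE1E.trans (subset_insert _ _),
      ?_, ?_, ?_, ?_⟩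
    · exact insert_subset (mem_union_right _ hrR.1) hER
    · intro x hx
      rw [Function.update_of_ne (by rintro rfl; exact hrE (hE1E hx))]
      exact hag x hx
    · rw [image_step hrE]
      exact insert_subset_insert _ hPE
    · intro x hx hx1
      rcases mem_insert.1 hx with h | h
      · subst h; rw [Function.update_self]; exact mem_insert_self _ _
      · rw [Function.update_of_ne (by rintro rfl; exact hrE h)]
        exact mem_insert_of_mem (hEP x h hx1)

theorem main [Fintype ι] (hS : Setup c G H D d ε)
    (hp : Par D (Fintype.card ι) d ε κ β γ η τ τ' m N) :
    ∃ ψ : V → V, Function.Injective ψ ∧ ∀ x y, H.Adj x y → G.Adj (ψ x) (ψ y) := by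
  obtain ⟨I, hIdef⟩ : ∃ I : Finset ι, I = univ.filter (fun i => N ≤ (cl c i).card) := ⟨_, rfl⟩
  have hI1 : ∀ i ∈ I, N ≤ (cl c i).card := by simp [hIdef]
  have hI2 : ∀ i, i ∉ I → (cl c i).card < N := by simp [hIdef]
  clear hIdef
  obtain ⟨B, R, hsel⟩ := exists_sel (c := c) hS.deg hp hI1
  set T : Finset V := univ.filter (fun z => ¬ ∃ r ∈ R, H.Adj r z) with hT
  have hη := hp.p2.hη
  have hbb : BadBound c G H d γ η m T I (Fintype.card ι) := by
    refine badBound_of hS hp hI1 fun i _ => ?_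
    have h1 := nb_card (c := c) hS.deg hp.hκ (by positivity : 0 ≤ 2 * η) hsel.Rrule
      (fun x hx => hsel.Rsz2 _ (hsel.RI x hx)) i
    have h2 : cl c i \ T = (cl c i).filter (fun y => ∃ x ∈ R, H.Adj x y) := by
      ext y; simp [hT]
    rw [h2]
    exact h1.trans (mul_le_mul_of_nonneg_right hp.hTγ (by positivity))
  set NB : Finset V := univ.filter (fun y => c y ∈ I ∧ ∃ b ∈ B, H.Adj b y) with hNB
  obtain ⟨φ1, hV1, hid, hpot1, hgood1⟩ := phase1 hS hp hI2 hsel T NB (by simp [hNB])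
  set E1 := E0 c I ∪ NB with hE1def
  have hE1 : ∀ x ∈ E1, c x ∉ I ∨ ∃ b ∈ B, H.Adj b x := by
    intro x hx
    rcases mem_union.1 hx with hx | hx
    · exact Or.inl (mem_E0.1 hx)
    · exact Or.inr (mem_filter.1 hx).2.2
  set W : Finset V := univ.filter (fun v => v ∉ E1.image φ1 ∧ c v ∈ I ∧
    (((B ∩ cl c (c v)).filter (fun b => v ∈ Cand c G H E1 φ1 b)).card : ℝ) <
      τ * (cl c (c v)).card) with hWdef
  have hWc : ∀ i ∈ I, ((W ∩ cl c i).card : ℝ) < η * (cl c i).card := by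
    intro i hi
    refine W_small hS hp hbb hsel hI1 hpot1 hi inter_subset_right fun v hv => ?_
    rw [mem_inter, mem_cl] at hv
    have h1 := (mem_filter.1 hv.1).2.2.2
    rw [hv.2] at h1
    exact h1
  obtain ⟨E, φ, hV, hE1E, hER, hag, hWE, hEW⟩ := fix hS hp hI2 hsel hV1 hE1 W
    (fun v hv => ⟨(mem_filter.1 hv).2.1, (mem_filter.1 hv).2.2.1⟩) hWc W Subset.rfl
  have hnew : ∀ y ∈ E, y ∉ E1 → y ∈ R := by
    intro y hy hy1
    rcases mem_union.1 (hER hy) with h | h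
    · exact absurd h hy1
    · exact h
  have hBI : ∀ x ∈ E, x ∉ B := by
    intro x hx hxB
    rcases mem_union.1 (hER hx) with h | h
    · rcases hE1 x h with h | ⟨b, hb, hbx⟩
      · exact h (hsel.BI x hxB)
      · exact hsel.far2 hb hxB hbx
    · exact disjoint_left.1 hsel.disj hxB h
  have hused : ∀ j ∈ I, ((cl c j ∩ E).card : ℝ) ≤ d ^ D / 4 * (cl c j).card := by
    intro j hj
    have h1 := used_NB hS hp hsel (P := E1) (j := j) (by
      intro y hy hyj
      rcases hE1 y hy with h | h
      · rw [hyj] at h; exact absurd hj h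
      · exact h)
    have h2 : cl c j ∩ E ⊆ (cl c j ∩ E1) ∪ (R ∩ cl c j) := by
      intro x hx
      rw [mem_inter] at hx
      rcases mem_union.1 (hER hx.2) with h | h
      · exact mem_union_left _ (mem_inter.2 ⟨hx.1, h⟩)
      · exact mem_union_right _ (mem_inter.2 ⟨h, hx.1⟩)
    have h3 : ((cl c j ∩ E).card : ℝ) ≤ (cl c j ∩ E1).card + (R ∩ cl c j).card := by
      exact_mod_cast (card_le_card h2).trans (card_union_le _ _)
    have h4 := hsel.Rsz2 j hj
    have h5 := mul_le_mul_of_nonneg_right hp.hused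
      (by positivity : (0 : ℝ) ≤ (cl c j).card)
    linarith
  have hsmall : ∀ z, z ∉ E → c z ∈ I := by
    intro z hz
    by_contra hcon
    exact hz (hE1E (mem_union_left _ (mem_E0.2 hcon)))
  have hcongr : ∀ z, (∀ r ∈ R, ¬ H.Adj r z) →
      Cand c G H E φ z = Cand c G H E1 φ1 z ∧ kk H E z = kk H E1 z := fun z hz =>
    Cand_congr hE1E hag fun y hy hy1 => hz y (hnew y hy hy1)
  have hInv : Inv c G H d β γ η τ m T B I (Fintype.card ι) E φ ∅ := by
    refine ⟨hV, hsmall, ?_, ?_, ?_, ?_, ?_, ?_, ?_, ?_⟩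
    · rw [Pot_congr (E := E1) (φ := φ1)]
      · exact hpot1
      · intro z hz
        refine hcongr z fun r hr hrz => ?_
        exact (mem_filter.1 hz).2 ⟨r, hr, hrz⟩
    · intro x hx hxB
      exact absurd hxB (hBI x hx)
    · intro b hb y hby
      refine hE1E ?_
      by_cases hyI : c y ∈ I
      · exact mem_union_right _ (mem_filter.2 ⟨mem_univ _, hyI, b, hb, hby⟩)
      · exact mem_union_left _ (mem_E0.2 hyI)
    · intro z hz _
      have hzI := hsmall z hz
      have hn : (0 : ℝ) ≤ (cl c (c z)).card := by positivity
      have h1 := Av_lower hV z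
      have h2 := hused _ hzI
      have hpd := pow_pos hS.hd D
      have h3 := mul_le_mul_of_nonneg_right (hp.tau_le hS) hn
      have hpn := mul_nonneg hpd.le hn
      have hz1 : z ∉ E1 := fun h => hz (hE1E h)
      suffices h4 : d ^ D / 2 * (cl c (c z)).card ≤ ((Cand c G H E φ z).card : ℝ) by
        linarith
      by_cases hr : ∃ r ∈ E, r ∈ R ∧ H.Adj r z
      · obtain ⟨r, hrE, hrR, hrz⟩ := hr
        have hsub : nbr G (φ r) ∩ cl c (c z) ⊆
            Cand c G H E φ z ∪ (cl c (c z) \ Cand c G H (E0 c I) id z) := by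
          intro v hv
          rw [mem_inter, mem_nbr] at hv
          by_cases hvC : v ∈ Cand c G H (E0 c I) id z
          · refine mem_union_left _ (mem_Cand.2 ⟨mem_cl.1 hv.2, fun y hy hyz => ?_⟩)
            by_cases hyr : y = r
            · rw [hyr]; exact hv.1
            rcases mem_union.1 (hER hy) with h | h
            · rcases mem_union.1 h with h0 | h0
              · rw [hag y h, hid y h0]
                exact (mem_Cand.1 hvC).2 y h0 hyz
              · obtain ⟨b, hb, hby⟩ := (mem_filter.1 h0).2.2
                exact (hsel.far1 hb hrR hby (Or.inr (Or.inr ⟨z, hyz, hrz.symm⟩))).elim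
            · exact (hsel.far3 h hrR hyr (Or.inr ⟨hyz, hrz.symm⟩)).elim
          · exact mem_union_right _ (mem_sdiff.2 ⟨hv.2, hvC⟩)
        have h4 : ((nbr G (φ r) ∩ cl c (c z)).card : ℝ) ≤ (Cand c G H E φ z).card +
            (cl c (c z) \ Cand c G H (E0 c I) id z).card := by
          exact_mod_cast (card_le_card hsub).trans (card_union_le _ _)
        have h5 := hS.mindeg r z hrz (φ r) (mem_cl.2 (hV.cls r hrE))
        have h6 := miss0 hS hp hI2 z
        have h7 : (kk H (E0 c I) z : ℝ) ≤ D := by exact_mod_cast kk_le hS _ z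
        have h8 : (kk H (E0 c I) z : ℝ) * (ε * (cl c (c z)).card) ≤
            η / 2 * (cl c (c z)).card := by
          calc _ ≤ (D : ℝ) * (ε * (cl c (c z)).card) := by
                have := hS.hε
                gcongr
            _ = D * ε * (cl c (c z)).card := by ring
            _ ≤ _ := by
              have := hp.hεη
              gcongr
        have h9 : d ^ D ≤ d := by
          calc d ^ D ≤ d ^ 1 := pow_le_pow_of_le_one hS.hd.le (by linarith [hS.hd2]) hp.hD
            _ = d := pow_one d
        have h10 : η ≤ d ^ D / 8 := by
          have h11 := hp.hused
          have : 0 ≤ D * (Fintype.card ι : ℝ) * (2 * β) / κ := by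
            have := hp.hκ
            have := hp.p2.hβ
            positivity
          linarith
        have h11 := mul_le_mul_of_nonneg_right h9 hn
        have h12 := mul_le_mul_of_nonneg_right h10 hn
        linarith
      · have h4 := (Cand_congr (c := c) (G := G) (z := z) hE1E hag
          fun y hy hy1 hyz => hr ⟨y, hy, hnew y hy hy1, hyz⟩).1
        rw [h4]
        have h5 := (hgood1 z hz1).card hS
        linarith
    · intro z _ h; simp at h
    · intro z h; simp at h
    · intro i _
      rw [empty_inter, card_empty, Nat.cast_zero]
      have := hp.p2.hγ
      positivity
    · intro v hv hvI
      have h0 : E1.image φ1 ⊆ E.image φ := by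
        intro w hw
        obtain ⟨x, hx, rfl⟩ := mem_image.1 hw
        exact mem_image.2 ⟨x, hE1E hx, hag x hx⟩
      have h1 : ¬ (((B ∩ cl c (c v)).filter (fun b => v ∈ Cand c G H E1 φ1 b)).card : ℝ) <
          τ * (cl c (c v)).card := fun h =>
        hv (hWE (mem_filter.2 ⟨mem_univ _, fun h' => hv (h0 h'), hvI, h⟩))
      push Not at h1
      refine h1.trans (le_of_eq ?_)
      congr 2
      refine filter_congr fun b hb => ?_
      rw [(hcongr b fun r hr hrb => ?_).1]
      exact hsel.far1 (mem_inter.1 hb).1 hr hrb.symm (Or.inl rfl)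
  refine hInv.exists hS hp.p2 hbb hsel.Bsz fun i hi => ?_
  have h1 : (N : ℝ) ≤ (cl c i).card := by exact_mod_cast hI1 i hi
  have h2 := hp.tau_pos hS
  nlinarith [hp.hNτ]
end
end BlowUp

namespace BlowUp

set_option maxHeartbeats 1000000 in
lemma exists_par (D f : ℕ) (hD : 1 ≤ D) (d : ℝ) (hd : 0 < d) (hd2 : d ≤ 1 / 2) :
    ∃ (ε κ β γ η τ τ' : ℝ) (m N : ℕ), 0 < ε ∧ Par D f d ε κ β γ η τ τ' m N := by
  have hDr : (1 : ℝ) ≤ D := by exact_mod_cast hD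
  have hfr : (0 : ℝ) ≤ f := by positivity
  set p := d ^ D with hpdef
  have hp0 : 0 < p := pow_pos hd D
  have hp1 : p ≤ 1 := pow_le_one₀ hd.le (by linarith)
  obtain ⟨κ, hκ⟩ : ∃ κ : ℝ, κ = 1 / (8 * D * (f + 1)) := ⟨_, rfl⟩
  have hκ0 : 0 < κ := by rw [hκ]; positivity
  have hκe : κ * (8 * D * (f + 1)) = 1 := by rw [hκ]; field_simp
  have hκ1 : κ ≤ 1 := by
    have : 1 ≤ 8 * (D : ℝ) * (f + 1) := by nlinarith
    nlinarith
  obtain ⟨β, hβ⟩ : ∃ β : ℝ, β = p * κ / (16 * (D + 1) ^ 3 * (f + 1)) := ⟨_, rfl⟩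
  have hβ0 : 0 < β := by rw [hβ]; positivity
  have hβe : β * (16 * (D + 1) ^ 3 * (f + 1)) = p * κ := by rw [hβ]; field_simp
  have hpκ : p * κ ≤ 1 := by nlinarith
  have hD3 : (D : ℝ) + 1 ≤ (D + 1) ^ 3 := by
    have : (1 : ℝ) ≤ (D + 1) ^ 2 := by nlinarith
    nlinarith
  have hX : (1 : ℝ) ≤ (D + 1) ^ 3 * (f + 1) := by nlinarith
  have hβ1 : β ≤ 1 / 2 := by nlinarith
  obtain ⟨τ, hτ⟩ : ∃ τ : ℝ, τ = p * β / 2 := ⟨_, rfl⟩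
  have hτ0 : 0 < τ := by rw [hτ]; positivity
  have hτβ : τ ≤ β / 2 := by rw [hτ]; nlinarith
  have hτp : τ ≤ p / 4 := by rw [hτ]; nlinarith
  have hq0 : 0 < d ^ (D + 1) := pow_pos hd _
  have hq1 : d ^ (D + 1) ≤ 1 := pow_le_one₀ hd.le (by linarith)
  obtain ⟨γ, hγ⟩ : ∃ γ : ℝ, γ = d ^ (D + 1) * τ / 4 := ⟨_, rfl⟩
  have hγ0 : 0 < γ := by rw [hγ]; positivity
  have hγτ : γ ≤ τ / 4 := by rw [hγ]; nlinarith
  obtain ⟨η, hη⟩ : ∃ η : ℝ, η = γ * κ / (4 * D * (f + 1)) := ⟨_, rfl⟩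
  have hη0 : 0 < η := by rw [hη]; positivity
  have hηe : η * (4 * D * (f + 1)) = γ * κ := by rw [hη]; field_simp
  have hηγ : η ≤ γ / 4 := by
    have h1 : 1 ≤ (D : ℝ) * (f + 1) := by nlinarith
    have h2 : γ * κ ≤ γ := by nlinarith
    nlinarith
  obtain ⟨m, hm⟩ := exists_nat_ge (((f : ℝ) + 1 + D) / (γ / 2))
  obtain ⟨N, hN⟩ := exists_nat_ge (1 + 1 / η + 2 / τ)
  have hη1 : 0 < 1 / η := by positivity
  have hτ1 : 0 < 2 / τ := by positivity
  have hN1 : (1 : ℝ) ≤ N := by linarith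
  have hMpos : (0 : ℝ) < ((2 : ℝ) ^ m) ^ D * D := by positivity
  obtain ⟨ε, hε⟩ : ∃ ε : ℝ, ε = min (min (p * η) (2 * γ))
    (min (γ / (((2 : ℝ) ^ m) ^ D * D)) (min (κ / N) (η / (2 * D)))) := ⟨_, rfl⟩
  have hε0 : 0 < ε := by rw [hε]; positivity
  have e1 : ε ≤ p * η := hε ▸ (min_le_left _ _).trans (min_le_left _ _)
  have e2 : ε ≤ 2 * γ := hε ▸ (min_le_left _ _).trans (min_le_right _ _)
  have e3 : ε ≤ γ / (((2 : ℝ) ^ m) ^ D * D) :=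
    hε ▸ (min_le_right _ _).trans (min_le_left _ _)
  have e4 : ε ≤ κ / N :=
    hε ▸ (min_le_right _ _).trans ((min_le_right _ _).trans (min_le_left _ _))
  have e5 : ε ≤ η / (2 * D) :=
    hε ▸ (min_le_right _ _).trans ((min_le_right _ _).trans (min_le_right _ _))
  refine ⟨ε, κ, β, γ, η, τ, γ, m, N, hε0, ?_⟩
  constructor
  · constructor
    · exact hβ0
    · exact hγ0
    · exact hη0
    · exact hγ0
    · exact hτ
    · linarith
    · linarith
    · have : 0 < d ^ (D + 1) * τ := by positivity
      rw [hγ]; linarith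
    · linarith
    · exact e1
    · exact e2
    · rw [le_div_iff₀ hMpos] at e3
      linarith
  · exact hD
  · exact hκ0
  · exact hκ1
  · clear hβ hβe hτ hγ hη hηe e1 e2 e3 e4 e5 hm hN hε
    have : 0 < (D : ℝ) * κ := by positivity
    linarith
  · have h1 : 0 < ((D : ℝ) + 1) ^ 3 * β := by positivity
    linarith
  · exact hβ1
  · have h1 : (D : ℝ) * f * (2 * β) / κ ≤ p / 8 := by
      rw [div_le_iff₀ hκ0]
      have h2 : (D : ℝ) * f ≤ (D + 1) ^ 3 * (f + 1) :=
        mul_le_mul (by linarith) (by linarith) hfr (by positivity)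
      have h3 := mul_le_mul_of_nonneg_left h2 hβ0.le
      linarith
    linarith
  · rw [div_le_iff₀ hκ0]
    have : 0 < η * D := by positivity
    linarith
  · rwa [div_le_iff₀ (by positivity)] at hm
  · exact_mod_cast hN1
  · have h1 : 1 / η ≤ N := by linarith
    rw [div_le_iff₀ hη0] at h1
    linarith
  · have h1 : 2 / τ ≤ N := by linarith
    rw [div_le_iff₀ hτ0] at h1
    linarith
  · rwa [le_div_iff₀ (by linarith)] at e4
  · rw [le_div_iff₀ (by positivity)] at e5
    linarith

end BlowUp

/-- The blow-up lemma of Komlós, Sárközy and Szemerédi. -/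
theorem blow_up_lemma (f : ℕ) (F : SimpleGraph (Fin f)) (d Δ : ℝ)
    (hd : 0 < d) (hΔ : 0 < Δ) :
    ∃ ε₀ : ℝ, 0 < ε₀ ∧
      ∀ (L : Fin f → ℕ) (ε : ℝ), ε ≤ ε₀ →
        -- `G` is a spanning subgraph of the blow-up `F*` of `F`
        ∀ G : SimpleGraph ((i : Fin f) × Fin (L i)),
          G ≤ SimpleGraph.comap Sigma.fst F →
          -- every edge of `F` corresponds to an `(ε,d)`-superregular pair of `G`
          (∀ i j : Fin f, F.Adj i j →
            IsSuperregularPair ε d G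
              (Finset.univ.filter fun x : (i : Fin f) × Fin (L i) => x.1 = i)
              (Finset.univ.filter fun x : (i : Fin f) × Fin (L i) => x.1 = j)) →
          -- `G` contains a copy of every subgraph `H` of `F*` of maximum degree at most `Δ`
          ∀ H : SimpleGraph ((i : Fin f) × Fin (L i)),
            H ≤ SimpleGraph.comap Sigma.fst F →
            (∀ x, (deg H x : ℝ) ≤ Δ) →
            ∃ φ : ((i : Fin f) × Fin (L i)) → ((i : Fin f) × Fin (L i)),
              Function.Injective φ ∧ ∀ x y, H.Adj x y → G.Adj (φ x) (φ y) := by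
  classical
  obtain ⟨e, κ, β, γ, η, τ, τ', m, N, he, hp⟩ := BlowUp.exists_par (⌈Δ⌉₊) f
    (Nat.ceil_pos.2 hΔ) (min d (1 / 2)) (lt_min hd (by norm_num)) (min_le_right _ _)
  refine ⟨e, he, ?_⟩
  intro L ε hε G hG hreg H hH hdeg
  have hcl : ∀ i : Fin f, (Finset.univ.filter fun x : (i : Fin f) × Fin (L i) => x.1 = i) =
      BlowUp.cl (Sigma.fst : ((i : Fin f) × Fin (L i)) → Fin f) i := by
    intro i; ext x; simp
  simp only [hcl] at hreg
  have hS : BlowUp.Setup (Sigma.fst : ((i : Fin f) × Fin (L i)) → Fin f) G H ⌈Δ⌉₊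
      (min d (1 / 2)) e := by
    refine ⟨lt_min hd (by norm_num), min_le_right _ _, he, ?_, ?_, ?_, ?_⟩
    · intro x
      have h1 : (BlowUp.nbr H x).card = deg H x := by
        unfold BlowUp.nbr deg
        congr 1
      rw [h1]
      have h2 := (hdeg x).trans (Nat.le_ceil Δ)
      exact_mod_cast h2
    · intro x y hxy
      have hF : F.Adj x.1 y.1 := hH hxy
      exact hF.ne
    · intro x y hxy Y hY hYc
      have hF : F.Adj x.1 y.1 := hH hxy
      by_contra hcon
      push Not at hcon
      obtain ⟨X, hXs, hXm, hXc⟩ : ∃ X ⊆ BlowUp.cl (Sigma.fst :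
          ((i : Fin f) × Fin (L i)) → Fin f) x.1,
          (∀ u ∈ X, ((BlowUp.nbr G u ∩ Y).card : ℝ) ≤ min d (1 / 2) * Y.card) ∧
          e * ((BlowUp.cl (Sigma.fst :
          ((i : Fin f) × Fin (L i)) → Fin f) x.1).card : ℝ) ≤ X.card := by
        refine ⟨_, Finset.filter_subset _ _, fun u hu => ?_, hcon⟩
        rw [Finset.mem_filter] at hu
        convert hu.2
      have h1 := (hreg _ _ hF).1 X hXs Y hY
        (le_trans (by gcongr) hXc) (le_trans (by gcongr) hYc)
      have h2 : (((X ×ˢ Y).filter fun p => G.Adj p.1 p.2).card : ℝ) ≤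
          d * (X.card * Y.card) := by
        have h3 : ((X ×ˢ Y).filter fun p => G.Adj p.1 p.2).card =
            ∑ u ∈ X, (BlowUp.nbr G u ∩ Y).card := by
          rw [Finset.card_filter, Finset.sum_product]
          refine Finset.sum_congr rfl fun u _ => ?_
          rw [← Finset.card_filter]
          congr 1
          ext w
          simp [and_comm]
        rw [h3]
        push_cast
        calc _ ≤ ∑ u ∈ X, d * (Y.card : ℝ) := by
              refine Finset.sum_le_sum fun u hu => (hXm u hu).trans ?_
              gcongr
              exact min_le_left _ _
          _ = _ := by rw [Finset.sum_const, nsmul_eq_mul]; ring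
      have h3 : dens G X Y ≤ d := by
        have h4 : dens G X Y = (((X ×ˢ Y).filter fun p => G.Adj p.1 p.2).card : ℝ) /
            (X.card * Y.card) := by
          unfold dens
          congr
        rw [h4]
        exact div_le_of_le_mul₀ (by positivity) hd.le h2
      linarith
    · intro x y hxy u hu
      have hF : F.Adj x.1 y.1 := hH hxy
      have h1 := (hreg _ _ hF).2.1 u hu
      have h2 : degIn G u (BlowUp.cl Sigma.fst y.1) =
          (BlowUp.nbr G u ∩ BlowUp.cl Sigma.fst y.1).card := by
        unfold degIn
        congr 1
        ext w
        simp [and_comm]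
      rw [h2] at h1
      have h3 := mul_le_mul_of_nonneg_right (min_le_left d (1 / 2)) (Nat.cast_nonneg
        (BlowUp.cl (Sigma.fst : ((i : Fin f) × Fin (L i)) → Fin f) y.1).card : (0 : ℝ) ≤ _)
      refine lt_of_le_of_lt h3 (lt_of_lt_of_le h1 (le_of_eq ?_))
      congr!
  have hp' : BlowUp.Par ⌈Δ⌉₊ (Fintype.card (Fin f)) (min d (1 / 2)) e κ β γ η τ τ' m N := by
    rw [Fintype.card_fin]; exact hp
  exact BlowUp.main hS hp'
end
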